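/- arXiv:2004.05650 — 2 statements merged into one kernel-verified Lean document; each statement's English description precedes it below -/
import Mathlib

section
/- Let m>1, 0<p<1 with m+p>2, σ>2(1−p)/(m−1). For every ξ₀∈(0,∞) there exists at most one profile with an interface of Type I at ξ₀: if f₁ and f₂ are solutions of the profile ODE, each positive on a left-neighborhood of ξ₀ and each having an interface of Type I at ξ₀, then f₁=f₂ on a left-neighborhood of ξ₀. -/
open Real Filter Set Topology

/-- The function `f^m` (real power). -/
noncomputable def Fm (m : ℝ) (f : ℝ → ℝ) : ℝ → ℝ := fun ξ => f ξ ^ m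

/-- `f` solves the self-similar profile ODE
`(f^m)'' - α f + β ξ f' + ξ^σ f^p = 0` on the set `S`. -/
noncomputable def SolvesODE (m p σ α β : ℝ) (f : ℝ → ℝ) (S : Set ℝ) : Prop :=
  ∀ ξ ∈ S,
    deriv (deriv (Fm m f)) ξ - α * f ξ + β * ξ * deriv f ξ + ξ ^ σ * f ξ ^ p = 0

/-- A profile: continuous and nonnegative on `[0,∞)`, with `f^m` of class `C²`
on the (positive-space) positivity set, solving the profile ODE there. -/
noncomputable def IsProfile (m p σ α β : ℝ) (f : ℝ → ℝ) : Prop :=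
  ContinuousOn f (Set.Ici 0) ∧ (∀ ξ ∈ Set.Ici (0 : ℝ), 0 ≤ f ξ) ∧
    ContDiffOn ℝ 2 (Fm m f) {ξ : ℝ | 0 < ξ ∧ 0 < f ξ} ∧
    SolvesODE m p σ α β f {ξ : ℝ | 0 < ξ ∧ 0 < f ξ}

/-- Behavior (P1) at the origin: `f(0) = a > 0`, `f'(0) = 0`. -/
noncomputable def GoodP1 (f : ℝ → ℝ) : Prop :=
  0 < f 0 ∧ HasDerivWithinAt f 0 (Set.Ici 0) 0

/-- Behavior (P2) at the origin: `f(0) = 0`, `(f^m)'(0) = 0`. -/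
noncomputable def GoodP2 (m : ℝ) (f : ℝ → ℝ) : Prop :=
  f 0 = 0 ∧ HasDerivWithinAt (Fm m f) 0 (Set.Ici 0) 0

/-- `f` has an interface at `ξ₀ ∈ (0,∞)`: `f(ξ₀) = 0`, `(f^m)'(ξ₀) = 0`, and
`f > 0` on a left-neighborhood of `ξ₀`. -/
noncomputable def HasInterface (m : ℝ) (f : ℝ → ℝ) (ξ₀ : ℝ) : Prop :=
  0 < ξ₀ ∧ f ξ₀ = 0 ∧ HasDerivAt (Fm m f) 0 ξ₀ ∧
    ∃ δ > 0, ∀ ξ ∈ Set.Ioo (ξ₀ - δ) ξ₀, 0 < f ξ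

/-- Type I interface behavior at `ξ₀`: `f(ξ)(ξ₀-ξ)^{-1/(m-1)}` has a finite
positive limit as `ξ → ξ₀⁻`. -/
noncomputable def TypeI (m : ℝ) (f : ℝ → ℝ) (ξ₀ : ℝ) : Prop :=
  ∃ L > 0, Filter.Tendsto (fun ξ => f ξ * (ξ₀ - ξ) ^ (-(1 / (m - 1))))
    (nhdsWithin ξ₀ (Set.Iio ξ₀)) (nhds L)

/-- Type II interface behavior at `ξ₀`: `f(ξ)(ξ₀-ξ)^{-1/(1-p)}` has a finite
positive limit as `ξ → ξ₀⁻`. -/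
noncomputable def TypeII (p : ℝ) (f : ℝ → ℝ) (ξ₀ : ℝ) : Prop :=
  ∃ L > 0, Filter.Tendsto (fun ξ => f ξ * (ξ₀ - ξ) ^ (-(1 / (1 - p))))
    (nhdsWithin ξ₀ (Set.Iio ξ₀)) (nhds L)

theorem HasDerivAt.eventually_gt_right {g : ℝ → ℝ} {s x : ℝ} (h : HasDerivAt g s x) (hs : 0 < s) :
    ∀ᶠ z in 𝓝[>] x, g x < g z := by
  have h1 := (hasDerivAt_iff_tendsto_slope_left_right.1 h).2
  filter_upwards [h1.eventually (eventually_gt_nhds hs), self_mem_nhdsWithin] with z hz hxz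
  have hxz' : 0 < z - x := sub_pos.2 hxz
  rw [slope_def_field] at hz
  have := (div_pos_iff_of_pos_right hxz').1 hz
  linarith

theorem HasDerivAt.eventually_lt_left {g : ℝ → ℝ} {s x : ℝ} (h : HasDerivAt g s x) (hs : 0 < s) :
    ∀ᶠ z in 𝓝[<] x, g z < g x := by
  have h1 := (hasDerivAt_iff_tendsto_slope_left_right.1 h).1
  filter_upwards [h1.eventually (eventually_gt_nhds hs), self_mem_nhdsWithin] with z hz hxz
  have hxz' : z - x < 0 := sub_neg.2 hxz
  rw [slope_def_field] at hz
  have := (div_pos_iff.1 hz).resolve_left (fun h => absurd h.2 (not_lt.2 hxz'.le))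
  linarith [this.1]

/-- If the second derivative of `v` is positive wherever `deriv v` equals `c`, then `deriv v`
cannot cross the level `c` downwards. -/
theorem deriv_no_downcrossing {v : ℝ → ℝ} {w x c : ℝ} (hwx : w < x)
    (hv : ∀ y ∈ Icc w x, DifferentiableAt ℝ v y)
    (hc : ∀ y ∈ Ioo w x, deriv v y = c → ∃ s > 0, HasDerivAt (deriv v) s y)
    (hw : c < deriv v w) : c ≤ deriv v x := by
  by_contra! hx
  have hg : ∀ y ∈ Icc w x, HasDerivAt (fun z => v z - c * z) (deriv v y - c) y := fun y hy => by
    have := (hv y hy).hasDerivAt.sub ((hasDerivAt_id y).const_mul c)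
    rw [mul_one] at this
    exact this
  obtain ⟨y, hy, hmax⟩ := isCompact_Icc.exists_isMaxOn (nonempty_Icc.2 hwx.le)
    (f := fun z => v z - c * z) (fun y hy => (hg y hy).continuousAt.continuousWithinAt)
  have hyw : w ≠ y := by
    rintro rfl
    obtain ⟨z, hz, hz'⟩ := (((hg w hy).eventually_gt_right (by linarith)).and
      (Ioo_mem_nhdsGT hwx)).exists
    exact absurd (hmax ⟨hz'.1.le, hz'.2.le⟩) (not_le.2 hz)
  have hyx : y ≠ x := by
    rintro rfl
    obtain ⟨z, hz, hz'⟩ := (((hg y hy).neg.eventually_lt_left (by linarith)).and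
      (Ioo_mem_nhdsLT hwx)).exists
    have := hmax ⟨hz'.1.le, hz'.2.le⟩
    simp only [Pi.neg_apply, mem_ofPred_eq] at hz this
    linarith
  have hyI : y ∈ Ioo w x := ⟨lt_of_le_of_ne hy.1 hyw, lt_of_le_of_ne hy.2 hyx⟩
  have h0 : deriv v y = c := by
    have := (hmax.isLocalMax (Icc_mem_nhds hyI.1 hyI.2)).hasDerivAt_eq_zero (hg y hy)
    linarith
  obtain ⟨s, hs, hds⟩ := hc y hyI h0
  obtain ⟨b, hb, hbs⟩ := (mem_nhdsGT_iff_exists_Ioo_subset' hyI.2).1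
    ((hds.eventually_gt_right hs).and (Ioo_mem_nhdsGT hyI.2))
  have hyb : y < (y + b) / 2 := by rw [mem_Ioi] at hb; linarith
  have hbI : (y + b) / 2 ∈ Ioo y b := by rw [mem_Ioi] at hb; constructor <;> linarith
  have hmem := (hbs hbI).2
  obtain ⟨t, ht, hts⟩ := exists_hasDerivAt_eq_slope (fun z => v z - c * z) (fun z => deriv v z - c)
    hyb (fun z hz => (hg z ⟨hy.1.trans hz.1, hz.2.trans hmem.2.le⟩).continuousAt.continuousWithinAt)
    (fun z hz => hg z ⟨hy.1.trans hz.1.le, hz.2.le.trans hmem.2.le⟩)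
  have htp : deriv v y < deriv v t := (hbs ⟨ht.1, ht.2.trans hbI.2⟩).1
  have hle : v ((y + b) / 2) - c * ((y + b) / 2) ≤ v y - c * y :=
    hmax ⟨hy.1.trans hmem.1.le, hmem.2.le⟩
  have : (v ((y + b) / 2) - c * ((y + b) / 2) - (v y - c * y)) / ((y + b) / 2 - y) ≤ 0 :=
    div_nonpos_of_nonpos_of_nonneg (by linarith) (by linarith)
  linarith

/-- If `deriv u` strictly decreases at each point where it is nonnegative, then `deriv u ≥ 0` at
a point forces `deriv u > 0` at all earlier points.  Here `deriv` takes the value `0` where `u` is not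
differentiable, and `u` need not be continuous. -/
theorem deriv_pos_of_deriv_nonneg_later {u : ℝ → ℝ} {a b x y : ℝ}
    (h : ∀ z ∈ Ioo a b, 0 ≤ deriv u z → ∃ s < 0, HasDerivAt (deriv u) s z)
    (hx : x ∈ Ioo a b) (hux : 0 ≤ deriv u x) (hay : a < y) (hyx : y < x) : 0 < deriv u y := by
  by_contra! hy
  set S := {z | z ∈ Icc y x ∧ z < x ∧ deriv u z ≤ 0} with hS
  have hSne : S.Nonempty := ⟨y, ⟨le_rfl, hyx.le⟩, hyx, hy⟩
  have hSb : BddAbove S := ⟨x, fun z hz => hz.2.1.le⟩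
  obtain ⟨s, hs, hds⟩ := h x hx hux
  have hleft : ∀ᶠ z in 𝓝[<] x, 0 < deriv u z := by
    filter_upwards [hds.neg.eventually_lt_left (by linarith)] with z hz
    simp only [Pi.neg_apply] at hz
    linarith
  obtain ⟨e, he, hes⟩ := (mem_nhdsLT_iff_exists_Ioo_subset' hyx).1 hleft
  have hle : sSup S ≤ e := csSup_le hSne fun z hz => by
    by_contra! hez
    exact absurd (hes ⟨hez, hz.2.1⟩) (not_lt.2 hz.2.2)
  set q := sSup S with hq
  have hqx : q < x := lt_of_le_of_lt hle he
  have hyq : y ≤ q := le_csSup hSb ⟨⟨le_rfl, hyx.le⟩, hyx, hy⟩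
  have hqI : q ∈ Ioo a b := ⟨by linarith, hqx.trans hx.2⟩
  have hpos : ∀ z ∈ Ioo q x, 0 < deriv u z := fun z hz => by
    by_contra! hz0
    exact absurd (le_csSup hSb ⟨⟨hyq.trans hz.1.le, hz.2.le⟩, hz.2, hz0⟩) (not_le.2 hz.1)
  rcases lt_trichotomy (deriv u q) 0 with h0 | h0 | h0
  · have hmid : (q + x) / 2 ∈ Ioo q x := by constructor <;> linarith
    have hne : ∀ z ∈ Icc q ((q + x) / 2), deriv u z ≠ 0 := fun z hz => by
      rcases eq_or_lt_of_le hz.1 with rfl | hz1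
      · exact h0.ne
      · exact (hpos z ⟨hz1, hz.2.trans_lt hmid.2⟩).ne'
    obtain ⟨z, hz, hz0⟩ := exists_hasDerivWithinAt_eq_of_gt_of_lt hmid.1.le
      (fun z hz => (differentiableAt_of_deriv_ne_zero (hne z hz)).hasDerivAt.hasDerivWithinAt)
      h0 (hpos _ hmid)
    exact hne z ⟨hz.1.le, hz.2.le⟩ hz0
  · obtain ⟨s, hs, hds⟩ := h q hqI h0.ge
    obtain ⟨z, hz, hz'⟩ := ((hds.neg.eventually_gt_right (by linarith)).and
      (Ioo_mem_nhdsGT hqx)).exists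
    simp only [Pi.neg_apply] at hz
    linarith [hpos z hz']
  · obtain ⟨s, hs, hds⟩ := h q hqI h0.le
    obtain ⟨c, d, hcd, hcds⟩ := mem_nhds_iff_exists_Ioo_subset.1
      (hds.continuousAt.eventually (eventually_gt_nhds h0))
    obtain ⟨z, hz, hcz⟩ := exists_lt_of_lt_csSup hSne (hq ▸ hcd.1)
    exact absurd (hcds ⟨hcz, (le_csSup hSb hz).trans_lt hcd.2⟩) (not_lt.2 hz.2.2)

/-- A positive function tending to `0` at `b` whose derivative strictly decreases wherever it is
nonnegative has negative derivative near `b`. -/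
theorem exists_forall_deriv_neg {u : ℝ → ℝ} {a b : ℝ} (hab : a < b)
    (h : ∀ z ∈ Ioo a b, 0 ≤ deriv u z → ∃ s < 0, HasDerivAt (deriv u) s z)
    (hpos : ∀ z ∈ Ioo a b, 0 < u z) (hlim : Tendsto u (𝓝[<] b) (𝓝 0)) :
    ∀ᶠ x in 𝓝[<] b, deriv u x < 0 := by
  by_contra hcon
  have hfr : ∃ᶠ x in 𝓝[<] b, 0 ≤ deriv u x := by
    refine fun hev => hcon (hev.mono fun x hx => not_le.1 hx)
  have hder : ∀ z ∈ Ioo a b, 0 < deriv u z := fun z hz => by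
    obtain ⟨x, hx, hx'⟩ := (hfr.and_eventually (Ioo_mem_nhdsLT hz.2)).exists
    exact deriv_pos_of_deriv_nonneg_later h ⟨hz.1.trans hx'.1, hx'.2⟩ hx hz.1 hx'.1
  have hmono : StrictMonoOn u (Ioo a b) := by
    refine strictMonoOn_of_deriv_pos (convex_Ioo a b) (fun z hz => ?_) (fun z hz => ?_)
    · exact (differentiableAt_of_deriv_ne_zero (hder z hz).ne').continuousAt.continuousWithinAt
    · rw [interior_Ioo] at hz
      exact hder z hz
  have hmid : (a + b) / 2 ∈ Ioo a b := by constructor <;> linarith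
  obtain ⟨x, hx, hx'⟩ := ((hlim.eventually (eventually_lt_nhds (hpos _ hmid))).and
    (Ioo_mem_nhdsLT hmid.2)).exists
  exact lt_asymm hx (hmono hmid ⟨hmid.1.trans hx'.1, hx'.2⟩ hx'.1)

theorem eventually_Ioo_pos {f : ℝ → ℝ} {a b x : ℝ} (hpos : ∀ y ∈ Ioo a b, 0 < f y)
    (hx : x ∈ Ioo a b) : ∀ᶠ y in 𝓝 x, 0 < f y :=
  eventually_of_mem (Ioo_mem_nhds hx.1 hx.2) hpos

theorem hasDerivAt_Fm {m x f' : ℝ} {f : ℝ → ℝ} (hx : 0 < f x) (hf : HasDerivAt f f' x) :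
    HasDerivAt (Fm m f) (m * f x ^ (m - 1) * f') x := by
  rw [show m * f x ^ (m - 1) * f' = f' * m * f x ^ (m - 1) by ring]
  exact hf.rpow_const (Or.inl hx.ne')

theorem differentiableAt_of_Fm {m x : ℝ} {f : ℝ → ℝ} (hm : m ≠ 0) (hpos : ∀ᶠ y in 𝓝 x, 0 < f y)
    (h : DifferentiableAt ℝ (Fm m f) x) : DifferentiableAt ℝ f x := by
  have hx : 0 < f x := hpos.self_of_nhds
  have h1 : DifferentiableAt ℝ (fun y => Fm m f y ^ (1 / m)) x :=
    h.rpow_const (Or.inl (rpow_pos_of_pos hx m).ne')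
  refine h1.congr_of_eventuallyEq (hpos.mono fun y hy => ?_)
  simp only [Fm]
  rw [← rpow_mul hy.le, mul_one_div_cancel hm, rpow_one]

theorem deriv_Fm {m x : ℝ} {f : ℝ → ℝ} (hm : m ≠ 0) (hpos : ∀ᶠ y in 𝓝 x, 0 < f y) :
    deriv (Fm m f) x = m * f x ^ (m - 1) * deriv f x := by
  by_cases hf : DifferentiableAt ℝ f x
  · exact (hasDerivAt_Fm hpos.self_of_nhds hf.hasDerivAt).deriv
  · rw [deriv_zero_of_not_differentiableAt hf, mul_zero]
    exact deriv_zero_of_not_differentiableAt fun h => hf (differentiableAt_of_Fm hm hpos h)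

theorem TypeI.tendsto_pressure {m ξ₀ : ℝ} {f : ℝ → ℝ} (hm : 1 < m)
    (hpos : ∀ᶠ x in 𝓝[<] ξ₀, 0 < f x) (h : TypeI m f ξ₀) :
    ∃ l > 0, Tendsto (fun x => f x ^ (m - 1) / (ξ₀ - x)) (𝓝[<] ξ₀) (𝓝 l) := by
  obtain ⟨L, hL, hlim⟩ := h
  refine ⟨L ^ (m - 1), rpow_pos_of_pos hL _, ?_⟩
  refine (hlim.rpow_const (p := m - 1) (Or.inl hL.ne')).congr' ?_
  filter_upwards [hpos, self_mem_nhdsWithin] with x hx hx'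
  have hd : 0 < ξ₀ - x := sub_pos.2 hx'
  rw [mul_rpow hx.le (rpow_nonneg hd.le _), ← rpow_mul hd.le, neg_mul,
    one_div_mul_cancel (by linarith), rpow_neg_one, div_eq_mul_inv]

theorem tendsto_sub_left_nhdsLT (b : ℝ) : Tendsto (fun x => b - x) (𝓝[<] b) (𝓝 0) := by
  have : Tendsto (fun x => b - x) (𝓝 b) (𝓝 (b - b)) := tendsto_const_nhds.sub tendsto_id
  rw [sub_self] at this
  exact this.mono_left nhdsWithin_le_nhds

theorem TypeI.tendsto_zero {m ξ₀ : ℝ} {f : ℝ → ℝ} (hm : 1 < m) (h : TypeI m f ξ₀) :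
    Tendsto f (𝓝[<] ξ₀) (𝓝 0) := by
  obtain ⟨L, hL, hlim⟩ := h
  have hr : 0 < 1 / (m - 1) := one_div_pos.2 (by linarith)
  have h1 := hlim.mul ((tendsto_sub_left_nhdsLT ξ₀).rpow_const (p := 1 / (m - 1)) (Or.inr hr.le))
  rw [zero_rpow hr.ne', mul_zero] at h1
  refine h1.congr' ?_
  filter_upwards [self_mem_nhdsWithin] with x hx'
  have hd : 0 < ξ₀ - x := sub_pos.2 hx'
  rw [mul_assoc, ← rpow_add hd, neg_add_cancel, rpow_zero, mul_one]

theorem TypeI.exists_bounds {m ξ₀ : ℝ} {f : ℝ → ℝ} (hm : 1 < m)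
    (hpos : ∀ᶠ x in 𝓝[<] ξ₀, 0 < f x) (h : TypeI m f ξ₀) :
    ∃ c > 0, ∃ C > 0, ∀ᶠ x in 𝓝[<] ξ₀,
      c * (ξ₀ - x) < f x ^ (m - 1) ∧ f x ^ (m - 1) < C * (ξ₀ - x) := by
  obtain ⟨l, hl, hlim⟩ := h.tendsto_pressure hm hpos
  refine ⟨l / 2, by positivity, 2 * l, by positivity, ?_⟩
  filter_upwards [hlim.eventually (eventually_gt_nhds (half_lt_self hl)),
    hlim.eventually (eventually_lt_nhds (show l < 2 * l by linarith)), self_mem_nhdsWithin]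
    with x h1 h2 hx'
  have hd : 0 < ξ₀ - x := sub_pos.2 hx'
  exact ⟨(lt_div_iff₀ hd).1 h1, (div_lt_iff₀ hd).1 h2⟩

/-- Near a Type I interface a solution is differentiable with `f^m` decreasing. -/
theorem TypeI.eventually_deriv_Fm_neg {m p σ α β ξ₀ a : ℝ} {f : ℝ → ℝ} (hm : 1 < m) (hp1 : p < 1)
    (hβ : 0 < β) (hξ₀ : 0 < ξ₀) (ha : a < ξ₀)
    (hpos : ∀ ξ ∈ Ioo a ξ₀, 0 < f ξ) (hode : SolvesODE m p σ α β f (Ioo a ξ₀))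
    (htype : TypeI m f ξ₀) : ∀ᶠ x in 𝓝[<] ξ₀, deriv (Fm m f) x < 0 := by
  have hf0 := htype.tendsto_zero hm
  have hid : Tendsto (fun x : ℝ => x) (𝓝[<] ξ₀) (𝓝 ξ₀) := tendsto_id.mono_left nhdsWithin_le_nhds
  have hsmall : ∀ᶠ x in 𝓝[<] ξ₀, α * f x ^ (1 - p) < x ^ σ := by
    have h1 := (hf0.rpow_const (p := 1 - p) (Or.inr (by linarith))).const_mul α
    rw [zero_rpow (by linarith), mul_zero] at h1
    exact h1.eventually_lt (hid.rpow_const (Or.inl hξ₀.ne')) (rpow_pos_of_pos hξ₀ σ)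
  have hposx : ∀ᶠ x in 𝓝[<] ξ₀, 0 < x := hid.eventually (eventually_gt_nhds hξ₀)
  obtain ⟨b, hb, hbs⟩ := (mem_nhdsLT_iff_exists_Ioo_subset' ha).1
    ((hsmall.and hposx).and (Ioo_mem_nhdsLT ha))
  have hb' : b < ξ₀ := hb
  have hlim : Tendsto (Fm m f) (𝓝[<] ξ₀) (𝓝 0) := by
    have := hf0.rpow_const (p := m) (Or.inr (by linarith))
    rwa [zero_rpow (by linarith)] at this
  refine exists_forall_deriv_neg hb' (fun z hz hGz => ?_)
    (fun z hz => rpow_pos_of_pos (hpos z (hbs hz).2) m) hlim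
  obtain ⟨⟨hsm, hz0⟩, hzI⟩ := hbs hz
  have hfz := hpos z hzI
  rw [deriv_Fm (by linarith) (eventually_Ioo_pos hpos hzI)] at hGz
  have hf' : 0 ≤ deriv f z := nonneg_of_mul_nonneg_right hGz (by positivity)
  have hH : deriv (deriv (Fm m f)) z < 0 := by
    have h1 := hode z hzI
    have h2 : f z = f z ^ (1 - p) * f z ^ p := by
      rw [← rpow_add hfz, sub_add_cancel, rpow_one]
    have h3 : α * f z < z ^ σ * f z ^ p := by
      calc α * f z = (α * f z ^ (1 - p)) * f z ^ p := by rw [mul_assoc, ← h2]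
        _ < z ^ σ * f z ^ p := mul_lt_mul_of_pos_right hsm (by positivity)
    have h4 : 0 ≤ β * z * deriv f z := by positivity
    linarith
  exact ⟨_, hH, (differentiableAt_of_deriv_ne_zero hH.ne).hasDerivAt⟩

/-- Near a Type I interface `f^m` is twice differentiable, whatever regularity was assumed. -/
theorem TypeI.eventually_hasDerivAt {m p σ α β ξ₀ a : ℝ} {f : ℝ → ℝ} (hm : 1 < m) (hp1 : p < 1)
    (hmp : 2 < m + p) (hα : 0 < α) (hβ : 0 < β) (hξ₀ : 0 < ξ₀) (ha : a < ξ₀)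
    (hpos : ∀ ξ ∈ Ioo a ξ₀, 0 < f ξ) (hode : SolvesODE m p σ α β f (Ioo a ξ₀))
    (htype : TypeI m f ξ₀) :
    ∀ᶠ x in 𝓝[<] ξ₀, DifferentiableAt ℝ f x ∧
      HasDerivAt (deriv (Fm m f)) (α * f x - x ^ σ * f x ^ p - β * x * deriv f x) x := by
  have hm1 : 0 < m - 1 := by linarith
  have hevpos : ∀ᶠ x in 𝓝[<] ξ₀, 0 < f x := eventually_of_mem (Ioo_mem_nhdsLT ha) hpos
  have hf0 := htype.tendsto_zero hm
  have hid : Tendsto (fun x : ℝ => x) (𝓝[<] ξ₀) (𝓝 ξ₀) := tendsto_id.mono_left nhdsWithin_le_nhds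
  obtain ⟨l, hl, C, -, hlC⟩ := htype.exists_bounds hm hevpos
  -- the negative of `j` is the level with which `f x ^ (m - 2) * deriv f x` is compared
  obtain ⟨j, hj, hjl, hjβ⟩ : ∃ j > 0, (m - 1) * j < l ∧ m * j < β * ξ₀ := by
    refine ⟨min (l / (m - 1)) (β * ξ₀ / m) / 2, by positivity, ?_, ?_⟩
    · have : min (l / (m - 1)) (β * ξ₀ / m) ≤ l / (m - 1) := min_le_left _ _
      rw [le_div_iff₀ hm1] at this
      linarith
    · have : min (l / (m - 1)) (β * ξ₀ / m) ≤ β * ξ₀ / m := min_le_right _ _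
      rw [le_div_iff₀ (by linarith)] at this
      have : 0 < β * ξ₀ := by positivity
      linarith
  have hsmall : ∀ᶠ x in 𝓝[<] ξ₀, x ^ σ * f x ^ (m + p - 2) < j * (β * x - m * j) := by
    have h1 := (hid.rpow_const (p := σ) (Or.inl hξ₀.ne')).mul
      (hf0.rpow_const (p := m + p - 2) (Or.inr (by linarith)))
    rw [zero_rpow (by linarith), mul_zero] at h1
    exact h1.eventually_lt (((hid.const_mul β).sub_const (m * j)).const_mul j)
      (mul_pos hj (by linarith))
  have hposx : ∀ᶠ x in 𝓝[<] ξ₀, 0 < x := hid.eventually (eventually_gt_nhds hξ₀)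
  obtain ⟨b, hb, hbs⟩ := (mem_nhdsLT_iff_exists_Ioo_subset' ha).1
    (((hsmall.and hposx).and (htype.eventually_deriv_Fm_neg hm hp1 hβ hξ₀ ha hpos hode)).and
      (Ioo_mem_nhdsLT ha))
  have hdiff : ∀ x ∈ Ioo b ξ₀, DifferentiableAt ℝ f x := fun x hx =>
    differentiableAt_of_Fm (by linarith) (eventually_Ioo_pos hpos (hbs hx).2)
      (differentiableAt_of_deriv_ne_zero (hbs hx).1.2.ne)
  have hG : ∀ x ∈ Ioo b ξ₀, f x ^ (m - 2) * deriv f x ≤ -j →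
      HasDerivAt (deriv (Fm m f)) (α * f x - x ^ σ * f x ^ p - β * x * deriv f x) x := by
    intro x hx hxj
    obtain ⟨⟨⟨hsm, hx0⟩, hGneg⟩, hxI⟩ := hbs hx
    have hfx := hpos x hxI
    have heq : deriv (deriv (Fm m f)) x = α * f x - x ^ σ * f x ^ p - β * x * deriv f x := by
      linarith [hode x hxI]
    have h1 : 0 < f x ^ (m - 2) * (α * f x - x ^ σ * f x ^ p - β * x * deriv f x) := by
      have e1 : f x ^ (m + p - 2) = f x ^ (m - 2) * f x ^ p := by
        rw [← rpow_add hfx]; ring_nf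
      have e2 : 0 < f x ^ (m - 2) * (α * f x) := by positivity
      have e3 : β * x * (f x ^ (m - 2) * deriv f x) ≤ β * x * (-j) :=
        mul_le_mul_of_nonneg_left hxj (by positivity)
      rw [e1] at hsm
      have e4 : 0 < j * (m * j) := by positivity
      linarith
    have h2 : deriv (deriv (Fm m f)) x ≠ 0 := by
      rw [heq]
      exact (pos_of_mul_pos_right h1 (by positivity)).ne'
    rw [← heq]
    exact (differentiableAt_of_deriv_ne_zero h2).hasDerivAt
  have hv : ∀ x ∈ Ioo b ξ₀, HasDerivAt (Fm (m - 1) f)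
      ((m - 1) * (f x ^ (m - 2) * deriv f x)) x := fun x hx => by
    convert hasDerivAt_Fm (m := m - 1) (hpos x (hbs hx).2) (hdiff x hx).hasDerivAt using 1
    rw [show m - 1 - 1 = m - 2 by ring, mul_assoc]
  have hcross : ∀ x ∈ Ioo b ξ₀, deriv (Fm (m - 1) f) x = -((m - 1) * j) →
      ∃ s > 0, HasDerivAt (deriv (Fm (m - 1) f)) s x := by
    intro x hx hxj
    obtain ⟨⟨⟨hsm, hx0⟩, hGneg⟩, hxI⟩ := hbs hx
    have hfx := hpos x hxI
    rw [(hv x hx).deriv] at hxj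
    have hxj' : f x ^ (m - 2) * deriv f x = -j := by
      exact mul_left_cancel₀ hm1.ne' (hxj.trans (neg_mul_eq_mul_neg _ _))
    have hquot : deriv (Fm (m - 1) f) =ᶠ[𝓝 x] fun y => (m - 1) / m * (deriv (Fm m f) y / f y) := by
      filter_upwards [Ioo_mem_nhds hx.1 hx.2] with y hy
      have hfy := hpos y (hbs hy).2
      rw [(hv y hy).deriv, deriv_Fm (by linarith) (eventually_Ioo_pos hpos (hbs hy).2),
        show m - 1 = m - 2 + 1 by ring, rpow_add_one hfy.ne']
      field_simp
    refine ⟨_, ?_, (((hG x hx hxj'.le).div (hdiff x hx).hasDerivAt hfx.ne').const_mul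
      ((m - 1) / m)).congr_of_eventuallyEq hquot⟩
    refine mul_pos (div_pos hm1 (by linarith)) (div_pos ?_ (by positivity))
    refine pos_of_mul_pos_right (a := f x ^ (m - 2)) ?_ (by positivity)
    rw [deriv_Fm (by linarith) (eventually_Ioo_pos hpos hxI)]
    have e1 : f x ^ (m + p - 2) = f x ^ (m - 2) * f x ^ p := by
      rw [← rpow_add hfx]; ring_nf
    have e2 : f x ^ (m - 1) = f x ^ (m - 2) * f x := by
      rw [← rpow_add_one hfx.ne']; ring_nf
    have e3 : f x ^ (m - 2) * ((α * f x - x ^ σ * f x ^ p - β * x * deriv f x) * f x -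
        m * f x ^ (m - 1) * deriv f x * deriv f x) =
        f x * (f x ^ (m - 2) * (α * f x) - x ^ σ * f x ^ (m + p - 2)
          - β * x * (f x ^ (m - 2) * deriv f x) - m * (f x ^ (m - 2) * deriv f x) ^ 2) := by
      rw [e1, e2]; ring
    rw [e3, hxj']
    refine mul_pos hfx ?_
    have e4 : 0 < f x ^ (m - 2) * (α * f x) := by positivity
    linarith
  filter_upwards [Ioo_mem_nhdsLT hb] with x hx
  refine ⟨hdiff x hx, hG x hx ?_⟩
  by_contra! hxj
  have hderiv : ∀ y ∈ Ioo x ξ₀, -((m - 1) * j) ≤ deriv (Fm (m - 1) f) y := fun y hy => by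
    refine deriv_no_downcrossing hy.1
      (fun z hz => (hv z ⟨hx.1.trans_le hz.1, hz.2.trans_lt hy.2⟩).differentiableAt)
      (fun z hz => hcross z ⟨hx.1.trans hz.1, hz.2.trans hy.2⟩) ?_
    rw [(hv x hx).deriv, neg_mul_eq_mul_neg]
    exact mul_lt_mul_of_pos_left hxj hm1
  have hv0 : Tendsto (Fm (m - 1) f) (𝓝[<] ξ₀) (𝓝 0) := by
    have := hf0.rpow_const (p := m - 1) (Or.inr hm1.le)
    rwa [zero_rpow hm1.ne'] at this
  obtain ⟨y, ⟨hyl, -⟩, hyI⟩ := (hlC.and (Ioo_mem_nhdsLT hx.2)).exists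
  have hle : Fm (m - 1) f y ≤ (m - 1) * j * (ξ₀ - y) := by
    have hlim := (hv0.sub_const (Fm (m - 1) f y)).sub ((hid.sub_const y).const_mul (-((m - 1) * j)))
    have hge : ∀ᶠ z in 𝓝[<] ξ₀, 0 ≤ Fm (m - 1) f z - Fm (m - 1) f y - -((m - 1) * j) * (z - y) := by
      filter_upwards [Ioo_mem_nhdsLT hyI.2] with z hz
      have hsub : ∀ w ∈ Icc y z, w ∈ Ioo b ξ₀ := fun w hw =>
        ⟨hx.1.trans (hyI.1.trans_le hw.1), hw.2.trans_lt hz.2⟩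
      have := Convex.mul_sub_le_image_sub_of_le_deriv (convex_Icc y z)
        (fun w hw => (hv w (hsub w hw)).continuousAt.continuousWithinAt)
        (fun w hw => (hv w (hsub w (interior_subset hw))).differentiableAt.differentiableWithinAt)
        (C := -((m - 1) * j)) (fun w hw => by
          rw [interior_Icc] at hw
          exact hderiv w ⟨hyI.1.trans hw.1, hw.2.trans hz.2⟩)
        y ⟨le_rfl, hz.1.le⟩ z ⟨hz.1.le, le_rfl⟩ hz.1.le
      linarith
    linarith [ge_of_tendsto hlim hge]
  have : (m - 1) * j * (ξ₀ - y) < l * (ξ₀ - y) :=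
    mul_lt_mul_of_pos_right hjl (sub_pos.2 hyI.2)
  simp only [Fm] at hle
  linarith

theorem hasDerivAt_flux {m p σ α β x : ℝ} {f : ℝ → ℝ} (hf : DifferentiableAt ℝ f x)
    (hG : HasDerivAt (deriv (Fm m f)) (α * f x - x ^ σ * f x ^ p - β * x * deriv f x) x) :
    HasDerivAt (fun y => deriv (Fm m f) y + β * y * f y)
      ((α + β) * f x - x ^ σ * f x ^ p) x := by
  have h := hG.add (((hasDerivAt_id x).const_mul β).mul hf.hasDerivAt)
  rw [show (α + β) * f x - x ^ σ * f x ^ p = α * f x - x ^ σ * f x ^ p - β * x * deriv f x +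
    (β * 1 * f x + β * id x * deriv f x) by simp only [id]; ring]
  exact h

/-- If the derivative of `u` vanishes at `b` from the left, then `deriv u` is frequently small to the
left of `b`. -/
theorem frequently_abs_deriv_lt {u : ℝ → ℝ} {b ε : ℝ} (hu : HasDerivWithinAt u 0 (Iic b) b)
    (hdiff : ∀ᶠ x in 𝓝[<] b, DifferentiableAt ℝ u x) (hε : 0 < ε) :
    ∃ᶠ x in 𝓝[<] b, |deriv u x| < ε := by
  intro hcon
  have hsl := (hasDerivWithinAt_iff_tendsto_slope' self_notMem_Iio).1 (hu.mono Iio_subset_Iic_self)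
  have hsl' := (hsl.abs.eventually (eventually_lt_nhds (show |(0 : ℝ)| < ε by simpa using hε)))
  obtain ⟨c, hc, hcs⟩ := (mem_nhdsLT_iff_exists_Ioo_subset' (sub_one_lt b)).1 (hcon.and hdiff)
  obtain ⟨x, hx, hxI⟩ := (hsl'.and (Ioo_mem_nhdsLT hc)).exists
  have hsub : ∀ y ∈ Ioo x b, y ∈ Ioo c b := fun y hy => ⟨hxI.1.trans hy.1, hy.2⟩
  have hcont : ContinuousOn u (Icc x b) := by
    intro y hy
    rcases eq_or_lt_of_le hy.2 with rfl | hyb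
    · exact hu.continuousWithinAt.mono Icc_subset_Iic_self
    · exact (hcs ⟨hxI.1.trans_le hy.1, hyb⟩).2.continuousAt.continuousWithinAt
  obtain ⟨y, hy, hys⟩ := exists_deriv_eq_slope u hxI.2 hcont
    (fun y hy => (hcs (hsub y hy)).2.differentiableWithinAt)
  refine (hcs (hsub y hy)).1 ?_
  show |deriv u y| < ε
  rw [hys]
  rwa [slope_comm, slope_def_field] at hx

/-- A function tending to `0` at `b` whose derivative is at most `A (b - x)^r` satisfies
`|g| ≤ A (b - x)^(r + 1)`. -/
theorem abs_le_of_abs_deriv_le_rpow {g g' : ℝ → ℝ} {a b A r : ℝ} (hA : 0 ≤ A) (hr : 0 ≤ r)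
    (hg : ∀ x ∈ Ioo a b, HasDerivAt g (g' x) x) (hg' : ∀ x ∈ Ioo a b, |g' x| ≤ A * (b - x) ^ r)
    (hlim : Tendsto g (𝓝[<] b) (𝓝 0)) {x : ℝ} (hx : x ∈ Ioo a b) :
    |g x| ≤ A * (b - x) ^ (r + 1) := by
  have hd : 0 < b - x := sub_pos.2 hx.2
  have hev : ∀ᶠ y in 𝓝[<] b, |g y - g x| ≤ A * (b - x) ^ (r + 1) := by
    filter_upwards [Ioo_mem_nhdsLT hx.2] with y hy
    have hsub : ∀ z ∈ Icc x y, z ∈ Ioo a b := fun z hz =>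
      ⟨hx.1.trans_le hz.1, hz.2.trans_lt hy.2⟩
    have h := (convex_Icc x y).norm_image_sub_le_of_norm_hasDerivWithin_le (C := A * (b - x) ^ r)
      (fun z hz => (hg z (hsub z hz)).hasDerivWithinAt)
      (fun z hz => (hg' z (hsub z hz)).trans (mul_le_mul_of_nonneg_left
        (rpow_le_rpow (by linarith [hz.2, hy.2]) (by linarith [hz.1]) hr) hA))
      ⟨le_rfl, hy.1.le⟩ ⟨hy.1.le, le_rfl⟩
    rw [norm_eq_abs, norm_eq_abs, abs_of_pos (sub_pos.2 hy.1)] at h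
    refine h.trans ?_
    rw [rpow_add_one hd.ne', ← mul_assoc]
    exact mul_le_mul_of_nonneg_left (by linarith [hy.2]) (by positivity)
  have := le_of_tendsto (hlim.sub_const (g x)).abs hev
  simpa using this

theorem TypeI.tendsto_flux {m p σ α β ξ₀ : ℝ} {f : ℝ → ℝ} (hm : 1 < m) (hp0 : 0 < p)
    (hξ₀ : 0 < ξ₀) (htype : TypeI m f ξ₀) (hder : HasDerivWithinAt (Fm m f) 0 (Iic ξ₀) ξ₀)
    (hpos : ∀ᶠ x in 𝓝[<] ξ₀, 0 < f x)
    (hode : ∀ᶠ x in 𝓝[<] ξ₀, DifferentiableAt ℝ f x ∧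
      HasDerivAt (deriv (Fm m f)) (α * f x - x ^ σ * f x ^ p - β * x * deriv f x) x) :
    Tendsto (fun x => deriv (Fm m f) x + β * x * f x) (𝓝[<] ξ₀) (𝓝 0) := by
  have hf0 := htype.tendsto_zero hm
  have hid : Tendsto (fun x : ℝ => x) (𝓝[<] ξ₀) (𝓝 ξ₀) := tendsto_id.mono_left nhdsWithin_le_nhds
  have hN : ∀ᶠ x in 𝓝[<] ξ₀, |(α + β) * f x - x ^ σ * f x ^ p| < 1 := by
    have h1 := ((hf0.const_mul (α + β)).sub ((hid.rpow_const (p := σ) (Or.inl hξ₀.ne')).mul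
      (hf0.rpow_const (p := p) (Or.inr hp0.le)))).abs
    rw [zero_rpow hp0.ne', mul_zero, mul_zero, sub_zero, abs_zero] at h1
    exact h1.eventually (eventually_lt_nhds one_pos)
  have hsmall : ∀ ε > 0, ∃ᶠ x in 𝓝[<] ξ₀, |deriv (Fm m f) x + β * x * f x| < ε := by
    intro ε hε
    have h1 := ((hid.const_mul β).mul hf0).abs
    rw [mul_zero, abs_zero] at h1
    refine ((frequently_abs_deriv_lt hder ?_ (half_pos hε)).and_eventually
      (h1.eventually (eventually_lt_nhds (half_pos hε)))).mono fun x hx => ?_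
    · filter_upwards [hpos, hode] with x hx hx'
      exact (hasDerivAt_Fm hx hx'.1.hasDerivAt).differentiableAt
    · linarith [hx.1, hx.2, abs_add_le (deriv (Fm m f) x) (β * x * f x)]
  obtain ⟨b, hb, hbs⟩ := (mem_nhdsLT_iff_exists_Ioo_subset' (sub_one_lt ξ₀)).1 (hN.and hode)
  refine squeeze_zero_norm' ?_ (tendsto_sub_left_nhdsLT ξ₀)
  filter_upwards [Ioo_mem_nhdsLT hb] with x hx
  refine le_of_forall_pos_lt_add fun ε hε => ?_
  obtain ⟨y, hyε, hy⟩ := ((hsmall ε hε).and_eventually (Ioo_mem_nhdsLT hx.2)).exists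
  have hsub : ∀ z ∈ Icc x y, z ∈ Ioo b ξ₀ := fun z hz => ⟨hx.1.trans_le hz.1, hz.2.trans_lt hy.2⟩
  have h := (convex_Icc x y).norm_image_sub_le_of_norm_hasDerivWithin_le (C := 1)
    (fun z hz => (hasDerivAt_flux (hbs (hsub z hz)).2.1
      (hbs (hsub z hz)).2.2).hasDerivWithinAt)
    (fun z hz => (hbs (hsub z hz)).1.le) ⟨hy.1.le, le_rfl⟩ ⟨le_rfl, hy.1.le⟩
  rw [norm_eq_abs, norm_eq_abs, abs_sub_comm x y, abs_of_pos (sub_pos.2 hy.1)] at h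
  rw [norm_eq_abs]
  linarith [hy.2, abs_sub_abs_le_abs_sub (deriv (Fm m f) x + β * x * f x)
    (deriv (Fm m f) y + β * y * f y)]

theorem exists_abs_rpow_sub_rpow_le {c C : ℝ} (hc : 0 < c) (r : ℝ) :
    ∃ K ≥ 0, ∀ d > 0, ∀ x ∈ Icc (c * d) (C * d), ∀ y ∈ Icc (c * d) (C * d),
      |x ^ r - y ^ r| ≤ K * d ^ (r - 1) * |x - y| := by
  obtain ⟨K, hK⟩ := isCompact_Icc.exists_bound_of_continuousOn (s := Icc c C)
    (f := fun x : ℝ => r * x ^ (r - 1))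
    (continuousOn_const.mul (continuousOn_id.rpow_const fun x hx => Or.inl (hc.trans_le hx.1).ne'))
  refine ⟨max K 0, le_max_right _ _, fun d hd x hx y hy => ?_⟩
  have h := (convex_Icc (c * d) (C * d)).norm_image_sub_le_of_norm_hasDerivWithin_le
    (f := fun x : ℝ => x ^ r) (f' := fun x => r * x ^ (r - 1)) (C := max K 0 * d ^ (r - 1))
    (fun z hz => (hasDerivAt_rpow_const
      (Or.inl ((mul_pos hc hd).trans_le hz.1).ne')).hasDerivWithinAt) (fun z hz => ?_) hy hx
  · exact h
  · have hzI : z / d ∈ Icc c C := ⟨(le_div_iff₀ hd).2 hz.1, (div_le_iff₀ hd).2 hz.2⟩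
    have hz0 : 0 < z / d := hc.trans_le hzI.1
    have : z = z / d * d := by field_simp
    rw [this, mul_rpow hz0.le hd.le, ← mul_assoc, norm_mul,
      norm_of_nonneg (rpow_nonneg hd.le (r - 1))]
    exact mul_le_mul_of_nonneg_right ((hK _ hzI).trans (le_max_left _ _)) (by positivity)

/-- Two-sided linear bounds on the pressure `f^(m-1)` and the profile equation with genuine
derivatives, at the point `x`. -/
structure RegularAt (m p σ α β ξ₀ c C : ℝ) (f : ℝ → ℝ) (x : ℝ) : Prop where
  pos : 0 < f x
  bounds : f x ^ (m - 1) ∈ Icc (c * (ξ₀ - x)) (C * (ξ₀ - x))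
  diff : DifferentiableAt ℝ f x
  ode : HasDerivAt (deriv (Fm m f)) (α * f x - x ^ σ * f x ^ p - β * x * deriv f x) x

namespace RegularAt

variable {m p σ α β ξ₀ c C x : ℝ} {f f₁ f₂ : ℝ → ℝ}

theorem mono {c' C' : ℝ} (h : RegularAt m p σ α β ξ₀ c C f x) (hc : c' ≤ c) (hC : C ≤ C')
    (hx : x < ξ₀) : RegularAt m p σ α β ξ₀ c' C' f x :=
  ⟨h.pos, ⟨(mul_le_mul_of_nonneg_right hc (sub_pos.2 hx).le).trans h.bounds.1,
    h.bounds.2.trans (mul_le_mul_of_nonneg_right hC (sub_pos.2 hx).le)⟩, h.diff, h.ode⟩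

theorem rpow_pressure (h : RegularAt m p σ α β ξ₀ c C f x) (hm : 1 < m) (s : ℝ) :
    (f x ^ (m - 1)) ^ (s * (1 / (m - 1))) = f x ^ s := by
  have : m - 1 ≠ 0 := by linarith
  rw [← rpow_mul h.pos.le]
  congr 1
  field_simp

theorem hasDerivAt_pressure (h : RegularAt m p σ α β ξ₀ c C f x) (hm : 1 < m) :
    HasDerivAt (Fm (m - 1) f)
      ((m - 1) / m * ((deriv (Fm m f) x + β * x * f x) * f x ^ (-1 : ℝ) - β * x)) x := by
  have hf := h.pos
  rw [(hasDerivAt_Fm hf h.diff.hasDerivAt).deriv]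
  convert hasDerivAt_Fm (m := m - 1) hf h.diff.hasDerivAt using 1
  rw [show f x ^ (m - 1) = f x ^ (m - 1 - 1) * f x by rw [← rpow_add_one hf.ne']; ring_nf,
    rpow_neg_one]
  field_simp
  ring

theorem abs_rpow_sub_le (h₁ : RegularAt m p σ α β ξ₀ c C f₁ x)
    (h₂ : RegularAt m p σ α β ξ₀ c C f₂ x) (hm : 1 < m) (hx : x < ξ₀) {s K M : ℝ} (hK : 0 ≤ K)
    (hlip : ∀ d > 0, ∀ y ∈ Icc (c * d) (C * d), ∀ z ∈ Icc (c * d) (C * d),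
      |y ^ (s * (1 / (m - 1))) - z ^ (s * (1 / (m - 1)))| ≤
        K * d ^ (s * (1 / (m - 1)) - 1) * |y - z|)
    (hM : |Fm (m - 1) f₁ x - Fm (m - 1) f₂ x| ≤ M * (ξ₀ - x)) :
    |f₁ x ^ s - f₂ x ^ s| ≤ K * M * (ξ₀ - x) ^ (s * (1 / (m - 1))) := by
  have hd : 0 < ξ₀ - x := sub_pos.2 hx
  have h := hlip _ hd _ h₁.bounds _ h₂.bounds
  rw [h₁.rpow_pressure hm, h₂.rpow_pressure hm] at h
  refine h.trans ((mul_le_mul_of_nonneg_left hM (by positivity)).trans_eq ?_)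
  rw [rpow_sub_one hd.ne']
  field_simp

theorem rpow_le (h : RegularAt m p σ α β ξ₀ c C f x) (hm : 1 < m) (hC : 0 ≤ C) (hx : x < ξ₀)
    {s : ℝ} (hs : 0 ≤ s) :
    f x ^ s ≤ C ^ (s * (1 / (m - 1))) * (ξ₀ - x) ^ (s * (1 / (m - 1))) := by
  have hr : 0 ≤ 1 / (m - 1) := one_div_nonneg.2 (by linarith)
  rw [← h.rpow_pressure hm, ← mul_rpow hC (sub_pos.2 hx).le]
  exact rpow_le_rpow (rpow_nonneg h.pos.le _) h.bounds.2 (by positivity)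

theorem rpow_neg_le (h : RegularAt m p σ α β ξ₀ c C f x) (hm : 1 < m) (hc : 0 < c) (hx : x < ξ₀) :
    f x ^ (-1 : ℝ) ≤ c ^ (-1 * (1 / (m - 1))) * (ξ₀ - x) ^ (-1 * (1 / (m - 1))) := by
  have hr : 0 ≤ 1 / (m - 1) := one_div_nonneg.2 (by linarith)
  rw [← h.rpow_pressure hm, ← mul_rpow hc.le (sub_pos.2 hx).le]
  exact rpow_le_rpow_of_nonpos (mul_pos hc (sub_pos.2 hx)) h.bounds.1 (by linarith)

end RegularAt

/-- The integral form of the profile equation gains a factor `(ξ₀ - x)^γ`, with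
`γ = (m + p - 2) / (m - 1) > 0`, on the difference of two pressures. -/
theorem exists_pressure_contraction {m p σ α β ξ₀ c C a : ℝ} {f₁ f₂ : ℝ → ℝ} (hm : 1 < m)
    (hp0 : 0 < p) (hp1 : p < 1) (hmp : 2 < m + p) (hσ : 0 < σ) (hα : 0 < α) (hβ : 0 < β)
    (hξ₀ : 0 < ξ₀) (hc : 0 < c) (hC : 0 < C) (ha0 : 0 ≤ a) (ha1 : ξ₀ - 1 ≤ a)
    (h₁ : ∀ x ∈ Ioo a ξ₀, RegularAt m p σ α β ξ₀ c C f₁ x)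
    (h₂ : ∀ x ∈ Ioo a ξ₀, RegularAt m p σ α β ξ₀ c C f₂ x)
    (hf₁ : Tendsto f₁ (𝓝[<] ξ₀) (𝓝 0)) (hf₂ : Tendsto f₂ (𝓝[<] ξ₀) (𝓝 0))
    (hE₁ : Tendsto (fun x => deriv (Fm m f₁) x + β * x * f₁ x) (𝓝[<] ξ₀) (𝓝 0))
    (hE₂ : Tendsto (fun x => deriv (Fm m f₂) x + β * x * f₂ x) (𝓝[<] ξ₀) (𝓝 0)) :
    ∃ K ≥ 0, ∀ b ≥ a, ∀ M ≥ 0,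
      (∀ x ∈ Ioo b ξ₀, |Fm (m - 1) f₁ x - Fm (m - 1) f₂ x| ≤ M * (ξ₀ - x)) →
      ∀ x ∈ Ioo b ξ₀, |Fm (m - 1) f₁ x - Fm (m - 1) f₂ x| ≤
        K * M * (ξ₀ - x) ^ ((m + p - 2) / (m - 1) + 1) := by
  have hm1 : 0 < m - 1 := by linarith
  obtain ⟨Ka, hKa, hlipa⟩ := exists_abs_rpow_sub_rpow_le (C := C) hc (1 * (1 / (m - 1)))
  obtain ⟨Kb, hKb, hlipb⟩ := exists_abs_rpow_sub_rpow_le (C := C) hc (p * (1 / (m - 1)))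
  obtain ⟨Kc, hKc, hlipc⟩ := exists_abs_rpow_sub_rpow_le (C := C) hc (-1 * (1 / (m - 1)))
  set r := 1 / (m - 1) with hr
  have hr0 : 0 < r := one_div_pos.2 hm1
  have hγ : (m + p - 2) / (m - 1) = (p * r + 1) + -1 * r := by rw [hr]; field_simp; ring
  set K₁ := (α + β) * Ka + ξ₀ ^ σ * Kb with hK₁
  set K₂ := (α + β) * C ^ (1 * r) + ξ₀ ^ σ * C ^ (p * r) with hK₂
  have hK₁0 : 0 ≤ K₁ := by positivity
  have hK₂0 : 0 ≤ K₂ := by positivity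
  have hpow : ∀ x ∈ Ioo a ξ₀, (ξ₀ - x) ^ (1 * r) ≤ (ξ₀ - x) ^ (p * r) := fun x hx =>
    rpow_le_rpow_of_exponent_ge (sub_pos.2 hx.2) (by linarith [hx.1])
      (mul_le_mul_of_nonneg_right hp1.le hr0.le)
  have hxσ : ∀ x ∈ Ioo a ξ₀, x ^ σ ≤ ξ₀ ^ σ := fun x hx =>
    rpow_le_rpow (ha0.trans hx.1.le) hx.2.le hσ.le
  have hE₂le : ∀ x ∈ Ioo a ξ₀,
      |deriv (Fm m f₂) x + β * x * f₂ x| ≤ K₂ * (ξ₀ - x) ^ (p * r + 1) := fun x hx => by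
    refine abs_le_of_abs_deriv_le_rpow hK₂0 (by positivity)
      (fun y hy => hasDerivAt_flux (h₂ y hy).diff (h₂ y hy).ode) (fun y hy => ?_) hE₂ hx
    have hy0 : 0 < y := ha0.trans_lt hy.1
    have hd : 0 < ξ₀ - y := sub_pos.2 hy.2
    have hfy := (h₂ y hy).pos
    have e1 := (h₂ y hy).rpow_le hm hC.le hy.2 zero_le_one
    have e2 := (h₂ y hy).rpow_le hm hC.le hy.2 hp0.le
    rw [rpow_one, ← hr] at e1
    rw [← hr] at e2
    calc |(α + β) * f₂ y - y ^ σ * f₂ y ^ p| ≤ |(α + β) * f₂ y| + |y ^ σ * f₂ y ^ p| := abs_sub _ _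
      _ = (α + β) * f₂ y + y ^ σ * f₂ y ^ p := by
        rw [abs_of_nonneg (by positivity), abs_of_nonneg (by positivity)]
      _ ≤ (α + β) * (C ^ (1 * r) * (ξ₀ - y) ^ (p * r)) +
          ξ₀ ^ σ * (C ^ (p * r) * (ξ₀ - y) ^ (p * r)) := by
        have e3 := e1.trans (mul_le_mul_of_nonneg_left (hpow y hy) (by positivity))
        have e4 := hxσ y hy
        gcongr
      _ = K₂ * (ξ₀ - y) ^ (p * r) := by rw [hK₂]; ring
  refine ⟨(m - 1) / m * (K₁ * c ^ (-1 * r) + K₂ * Kc), by positivity, fun b hb M hM hw x hx => ?_⟩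
  have hsub : ∀ y ∈ Ioo b ξ₀, y ∈ Ioo a ξ₀ := fun y hy => ⟨hb.trans_lt hy.1, hy.2⟩
  have hDle : ∀ x ∈ Ioo b ξ₀, |(deriv (Fm m f₁) x + β * x * f₁ x) -
      (deriv (Fm m f₂) x + β * x * f₂ x)| ≤ K₁ * M * (ξ₀ - x) ^ (p * r + 1) := fun x hx => by
    have hlim := hE₁.sub hE₂
    rw [sub_zero] at hlim
    refine abs_le_of_abs_deriv_le_rpow (by positivity) (by positivity)
      (fun y hy => (hasDerivAt_flux (h₁ y (hsub y hy)).diff (h₁ y (hsub y hy)).ode).sub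
        (hasDerivAt_flux (h₂ y (hsub y hy)).diff (h₂ y (hsub y hy)).ode))
      (fun y hy => ?_) hlim hx
    have hy0 : 0 < y := ha0.trans_lt (hsub y hy).1
    have hd : 0 < ξ₀ - y := sub_pos.2 hy.2
    have e1 := (h₁ y (hsub y hy)).abs_rpow_sub_le (h₂ y (hsub y hy)) hm hy.2 hKa hlipa (hw y hy)
    have e2 := (h₁ y (hsub y hy)).abs_rpow_sub_le (h₂ y (hsub y hy)) hm hy.2 hKb hlipb (hw y hy)
    rw [rpow_one, rpow_one, ← hr] at e1
    rw [← hr] at e2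
    calc |(α + β) * f₁ y - y ^ σ * f₁ y ^ p - ((α + β) * f₂ y - y ^ σ * f₂ y ^ p)|
        = |(α + β) * (f₁ y - f₂ y) - y ^ σ * (f₁ y ^ p - f₂ y ^ p)| := by congr 1; ring
      _ ≤ |(α + β) * (f₁ y - f₂ y)| + |y ^ σ * (f₁ y ^ p - f₂ y ^ p)| := abs_sub _ _
      _ = (α + β) * |f₁ y - f₂ y| + y ^ σ * |f₁ y ^ p - f₂ y ^ p| := by
        rw [abs_mul, abs_mul, abs_of_nonneg (by positivity : 0 ≤ α + β),
          abs_of_nonneg (by positivity : 0 ≤ y ^ σ)]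
      _ ≤ (α + β) * (Ka * M * (ξ₀ - y) ^ (p * r)) + ξ₀ ^ σ * (Kb * M * (ξ₀ - y) ^ (p * r)) := by
        have e3 := e1.trans (mul_le_mul_of_nonneg_left (hpow y (hsub y hy)) (by positivity))
        have e4 := hxσ y (hsub y hy)
        gcongr
      _ = K₁ * M * (ξ₀ - y) ^ (p * r) := by rw [hK₁]; ring
  have hlim := (hf₁.rpow_const (p := m - 1) (Or.inr hm1.le)).sub
    (hf₂.rpow_const (p := m - 1) (Or.inr hm1.le))
  rw [sub_self] at hlim
  refine abs_le_of_abs_deriv_le_rpow (g := fun x => Fm (m - 1) f₁ x - Fm (m - 1) f₂ x)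
    (by positivity) (div_nonneg (by linarith) hm1.le)
    (fun y hy => ((h₁ y (hsub y hy)).hasDerivAt_pressure hm).sub
      ((h₂ y (hsub y hy)).hasDerivAt_pressure hm)) (fun y hy => ?_) hlim hx
  have hd : 0 < ξ₀ - y := sub_pos.2 hy.2
  have hf₁y := (h₁ y (hsub y hy)).pos
  have e1 := (h₁ y (hsub y hy)).rpow_neg_le hm hc hy.2
  have e2 := (h₁ y (hsub y hy)).abs_rpow_sub_le (h₂ y (hsub y hy)) hm hy.2 hKc hlipc (hw y hy)
  have e3 := hDle y hy
  have e4 := hE₂le y (hsub y hy)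
  rw [← hr] at e1 e2
  rw [hγ, rpow_add hd]
  generalize deriv (Fm m f₁) y + β * y * f₁ y = E₁ at e3 ⊢
  generalize deriv (Fm m f₂) y + β * y * f₂ y = E₂ at e3 e4 ⊢
  calc |(m - 1) / m * (E₁ * f₁ y ^ (-1 : ℝ) - β * y) - (m - 1) / m * (E₂ * f₂ y ^ (-1 : ℝ) - β * y)|
      = |(m - 1) / m * ((E₁ - E₂) * f₁ y ^ (-1 : ℝ)
          + E₂ * (f₁ y ^ (-1 : ℝ) - f₂ y ^ (-1 : ℝ)))| := by congr 1; ring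
    _ = (m - 1) / m * |(E₁ - E₂) * f₁ y ^ (-1 : ℝ)
          + E₂ * (f₁ y ^ (-1 : ℝ) - f₂ y ^ (-1 : ℝ))| := by
      rw [abs_mul, abs_of_nonneg (by positivity : 0 ≤ (m - 1) / m)]
    _ ≤ (m - 1) / m * (|E₁ - E₂| * f₁ y ^ (-1 : ℝ)
          + |E₂| * |f₁ y ^ (-1 : ℝ) - f₂ y ^ (-1 : ℝ)|) := by
      refine mul_le_mul_of_nonneg_left ((abs_add_le _ _).trans_eq ?_) (by positivity)
      rw [abs_mul, abs_mul, abs_of_nonneg (by positivity : 0 ≤ f₁ y ^ (-1 : ℝ))]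
    _ ≤ (m - 1) / m * (K₁ * M * (ξ₀ - y) ^ (p * r + 1) * (c ^ (-1 * r) * (ξ₀ - y) ^ (-1 * r))
          + K₂ * (ξ₀ - y) ^ (p * r + 1) * (Kc * M * (ξ₀ - y) ^ (-1 * r))) := by
      gcongr
    _ = _ := by ring

theorem TypeI.exists_eventually_regularAt {m p σ α β ξ₀ a : ℝ} {f : ℝ → ℝ} (hm : 1 < m)
    (hp1 : p < 1) (hmp : 2 < m + p) (hα : 0 < α) (hβ : 0 < β) (hξ₀ : 0 < ξ₀) (ha : a < ξ₀)
    (hpos : ∀ ξ ∈ Ioo a ξ₀, 0 < f ξ) (hode : SolvesODE m p σ α β f (Ioo a ξ₀))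
    (htype : TypeI m f ξ₀) :
    ∃ c > 0, ∃ C > 0, ∀ᶠ x in 𝓝[<] ξ₀, RegularAt m p σ α β ξ₀ c C f x := by
  have hevpos : ∀ᶠ x in 𝓝[<] ξ₀, 0 < f x := eventually_of_mem (Ioo_mem_nhdsLT ha) hpos
  obtain ⟨c, hc, C, hC, hbd⟩ := htype.exists_bounds hm hevpos
  refine ⟨c, hc, C, hC, ?_⟩
  filter_upwards [hevpos, hbd, htype.eventually_hasDerivAt hm hp1 hmp hα hβ hξ₀ ha hpos hode]
    with x h1 h2 h3
  exact ⟨h1, ⟨h2.1.le, h2.2.le⟩, h3.1, h3.2⟩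

/-- local uniqueness of the Type I interface behavior: two
solutions of the profile ODE, positive on a left-neighborhood of `ξ₀` and both
having an interface of Type I at `ξ₀`, coincide on a left-neighborhood of
`ξ₀`. -/
theorem local_uniqueness_typeI_interface (m p σ α β : ℝ)
    (hm : 1 < m) (hp0 : 0 < p) (hp1 : p < 1) (hmp : 2 < m + p)
    (hσ : 2 * (1 - p) / (m - 1) < σ)
    (hα : α = (σ + 2) / (σ * (m - 1) + 2 * (p - 1)))
    (hβ : β = (m - p) / (σ * (m - 1) + 2 * (p - 1)))
    (ξ₀ : ℝ) (hξ₀ : 0 < ξ₀)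
    (f₁ f₂ : ℝ → ℝ) (δ₁ δ₂ : ℝ) (hδ₁ : 0 < δ₁) (hδ₂ : 0 < δ₂)
    (hpos₁ : ∀ ξ ∈ Set.Ioo (ξ₀ - δ₁) ξ₀, 0 < f₁ ξ)
    (hode₁ : SolvesODE m p σ α β f₁ (Set.Ioo (ξ₀ - δ₁) ξ₀))
    (hzero₁ : f₁ ξ₀ = 0)
    (hder₁ : HasDerivWithinAt (Fm m f₁) 0 (Set.Iic ξ₀) ξ₀)
    (htype₁ : TypeI m f₁ ξ₀)
    (hpos₂ : ∀ ξ ∈ Set.Ioo (ξ₀ - δ₂) ξ₀, 0 < f₂ ξ)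
    (hode₂ : SolvesODE m p σ α β f₂ (Set.Ioo (ξ₀ - δ₂) ξ₀))
    (hzero₂ : f₂ ξ₀ = 0)
    (hder₂ : HasDerivWithinAt (Fm m f₂) 0 (Set.Iic ξ₀) ξ₀)
    (htype₂ : TypeI m f₂ ξ₀) :
    ∃ δ > 0, ∀ ξ ∈ Set.Ioo (ξ₀ - δ) ξ₀, f₁ ξ = f₂ ξ := by
  have hm1 : 0 < m - 1 := by linarith
  have hσ0 : 0 < σ := lt_of_le_of_lt (div_nonneg (by linarith) hm1.le) hσ
  have hden : 0 < σ * (m - 1) + 2 * (p - 1) := by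
    rw [div_lt_iff₀ hm1] at hσ
    linarith
  have hα0 : 0 < α := hα ▸ div_pos (by linarith) hden
  have hβ0 : 0 < β := hβ ▸ div_pos (by linarith) hden
  obtain ⟨c₁, hc₁, C₁, hC₁, hreg₁⟩ := htype₁.exists_eventually_regularAt hm hp1 hmp hα0 hβ0 hξ₀
    (sub_lt_self ξ₀ hδ₁) hpos₁ hode₁
  obtain ⟨c₂, hc₂, C₂, hC₂, hreg₂⟩ := htype₂.exists_eventually_regularAt hm hp1 hmp hα0 hβ0 hξ₀
    (sub_lt_self ξ₀ hδ₂) hpos₂ hode₂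
  have hE₁ := htype₁.tendsto_flux hm hp0 hξ₀ hder₁ (hreg₁.mono fun x h => h.pos)
    (hreg₁.mono fun x h => ⟨h.diff, h.ode⟩)
  have hE₂ := htype₂.tendsto_flux hm hp0 hξ₀ hder₂ (hreg₂.mono fun x h => h.pos)
    (hreg₂.mono fun x h => ⟨h.diff, h.ode⟩)
  have hmax : max 0 (ξ₀ - 1) < ξ₀ := max_lt hξ₀ (sub_one_lt ξ₀)
  obtain ⟨a, ha, has⟩ := (mem_nhdsLT_iff_exists_mem_Ico_Ioo_subset hmax).1 (hreg₁.and hreg₂)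
  have hc : 0 < min c₁ c₂ := lt_min hc₁ hc₂
  have hC : 0 < max C₁ C₂ := lt_max_of_lt_left hC₁
  have hr₁ : ∀ x ∈ Ioo a ξ₀, RegularAt m p σ α β ξ₀ (min c₁ c₂) (max C₁ C₂) f₁ x := fun x hx =>
    (has hx).1.mono (min_le_left _ _) (le_max_left _ _) hx.2
  have hr₂ : ∀ x ∈ Ioo a ξ₀, RegularAt m p σ α β ξ₀ (min c₁ c₂) (max C₁ C₂) f₂ x := fun x hx =>
    (has hx).2.mono (min_le_right _ _) (le_max_right _ _) hx.2
  obtain ⟨K, hK, hcontr⟩ := exists_pressure_contraction hm hp0 hp1 hmp hσ0 hα0 hβ0 hξ₀ hc hC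
    ((le_max_left _ _).trans ha.1) ((le_max_right _ _).trans ha.1) hr₁ hr₂
    (htype₁.tendsto_zero hm) (htype₂.tendsto_zero hm) hE₁ hE₂
  have hγ : 0 < (m + p - 2) / (m - 1) := div_pos (by linarith) hm1
  have hhalf : ∀ᶠ x in 𝓝[<] ξ₀, K * (ξ₀ - x) ^ ((m + p - 2) / (m - 1)) < 1 / 2 := by
    have h := ((tendsto_sub_left_nhdsLT ξ₀).rpow_const (Or.inr hγ.le)).const_mul K
    rw [zero_rpow hγ.ne', mul_zero] at h
    exact h.eventually (eventually_lt_nhds one_half_pos)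
  obtain ⟨b, hb, hbs⟩ := (mem_nhdsLT_iff_exists_mem_Ico_Ioo_subset ha.2).1 hhalf
  have hgeom : ∀ n : ℕ, ∀ x ∈ Ioo b ξ₀, |Fm (m - 1) f₁ x - Fm (m - 1) f₂ x| ≤
      max C₁ C₂ * (1 / 2) ^ n * (ξ₀ - x) := by
    intro n
    induction n with
    | zero =>
      intro x hx
      have hxa : x ∈ Ioo a ξ₀ := ⟨hb.1.trans_lt hx.1, hx.2⟩
      have hd : 0 < ξ₀ - x := sub_pos.2 hx.2
      have h1 := (hr₁ x hxa).bounds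
      have h2 := (hr₂ x hxa).bounds
      have h3 : 0 < min c₁ c₂ * (ξ₀ - x) := mul_pos hc hd
      rw [pow_zero, mul_one, abs_le]
      simp only [Fm]
      constructor <;> linarith [h1.1, h1.2, h2.1, h2.2]
    | succ n ih =>
      intro x hx
      have hd : 0 < ξ₀ - x := sub_pos.2 hx.2
      refine (hcontr b hb.1 _ (by positivity) ih x hx).trans ?_
      have h1 : K * (ξ₀ - x) ^ ((m + p - 2) / (m - 1)) ≤ 1 / 2 := (hbs hx).le
      have h2 : 0 ≤ max C₁ C₂ * (1 / 2) ^ n * (ξ₀ - x) := by positivity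
      rw [rpow_add_one hd.ne', pow_succ]
      linarith [mul_le_mul_of_nonneg_right h1 h2]
  refine ⟨ξ₀ - b, sub_pos.2 hb.2, fun x hx => ?_⟩
  rw [sub_sub_cancel] at hx
  have hxa : x ∈ Ioo a ξ₀ := ⟨hb.1.trans_lt hx.1, hx.2⟩
  have hlim : Tendsto (fun n : ℕ => max C₁ C₂ * (1 / 2) ^ n * (ξ₀ - x)) atTop (𝓝 0) := by
    have h := ((tendsto_pow_atTop_nhds_zero_of_lt_one (r := (1 / 2 : ℝ)) (by norm_num)
      (by norm_num)).const_mul (max C₁ C₂)).mul_const (ξ₀ - x)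
    rwa [mul_zero, zero_mul] at h
  have hzero := abs_nonpos_iff.1 (ge_of_tendsto' hlim fun n => hgeom n x hx)
  exact (rpow_left_inj (hr₁ x hxa).pos.le (hr₂ x hxa).pos.le hm1.ne').1 (sub_eq_zero.1 hzero)
end

section
/- Let m>1, 0<p<1, σ>2(1−p)/(m−1), and set α=(σ+2)/(σ(m−1)+2(p−1))>0, β=(m−p)/(σ(m−1)+2(p−1))>0. Then there exists a differentiable curve (X,Y):ℝ→ℝ² with X(η)>0 for all η∈ℝ, solving the planar system X'(η)=X(η)[(m−1)Y(η)−2X(η)], Y'(η)=−Y(η)²−(β/α)Y(η)+X(η)−X(η)Y(η), such that (X(η),Y(η))→(0,0) as η→−∞ and (X(η),Y(η))→((m−1)/(2(m+1)α), 1/((m+1)α)) as η→+∞ (a heteroclinic orbit connecting the critical points P₀ and P₂ in the invariant plane {Z=0}). -/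
open Real Filter Set Topology

open scoped NNReal

section GlobalFlow

variable {E : Type*} [NormedAddCommGroup E] [NormedSpace ℝ E] {f : E → E} {K L : ℝ≥0}

/-- A bounded Lipschitz vector field on a Banach space has a global integral curve through every
point. -/
theorem exists_forall_hasDerivAt_of_lipschitzWith_of_bounded [CompleteSpace E]
    (hf : LipschitzWith K f) (hb : ∀ x, ‖f x‖ ≤ L) (x₀ : E) :
    ∃ z : ℝ → E, z 0 = x₀ ∧ ∀ t, HasDerivAt z (f (z t)) t := by
  have local_curve (n : ℕ) : ∃ a : ℝ → E, a 0 = x₀ ∧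
      ∀ t ∈ Ioo (-(n + 1 : ℝ)) (n + 1), HasDerivAt a (f (a t)) t := by
    have hn : (0 : ℝ) ≤ n + 1 := by positivity
    have hpl : IsPicardLindelof (fun _ : ℝ ↦ f) (tmin := -(n + 1 : ℝ)) (tmax := n + 1)
        ⟨0, neg_nonpos.mpr hn, hn⟩ x₀ (L * (n + 1)) 0 L K := by
      refine .of_time_independent (fun x _ ↦ hb x) hf.lipschitzOnWith ?_
      simp
    obtain ⟨a, ha0, ha⟩ := hpl.exists_eq_forall_mem_Icc_hasDerivWithinAt₀
    exact ⟨a, ha0, fun t ht ↦ (ha t (Ioo_subset_Icc_self ht)).hasDerivAt (Icc_mem_nhds ht.1 ht.2)⟩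
  choose a ha0 ha using local_curve
  have agree {i j : ℕ} (hij : i ≤ j) {t : ℝ} (ht : |t| < i + 1) : a i t = a j t := by
    have hij' : (i : ℝ) ≤ j := by exact_mod_cast hij
    refine ODE_solution_unique_of_mem_Ioo (v := fun _ ↦ f) (s := fun _ ↦ univ) (K := K)
      (t₀ := 0) (a := -(i + 1 : ℝ)) (b := i + 1) (fun _ _ ↦ hf.lipschitzOnWith)
      ⟨by linarith [i.cast_nonneg (α := ℝ)], by positivity⟩ (fun s hs ↦ ⟨ha i s hs, mem_univ _⟩)
      (fun s hs ↦ ⟨ha j s ⟨by linarith [hs.1], by linarith [hs.2]⟩, mem_univ _⟩)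
      (by rw [ha0, ha0]) (abs_lt.mp ht)
  refine ⟨fun t ↦ a ⌈|t|⌉₊ t, ha0 _, fun t ↦ ?_⟩
  have eq_of_lt {i : ℕ} {s : ℝ} (hs : |s| < i + 1) : a ⌈|s|⌉₊ s = a i s := by
    rcases le_total ⌈|s|⌉₊ i with h | h
    · exact agree h ((Nat.le_ceil _).trans_lt (lt_add_one _))
    · exact (agree h hs).symm
  have ht : |t| < ⌈|t|⌉₊ + 1 := (Nat.le_ceil _).trans_lt (lt_add_one _)
  refine (ha ⌈|t|⌉₊ t (abs_lt.mp ht)).congr_of_eventuallyEq ?_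
  filter_upwards [continuous_abs.continuousAt.eventually_lt continuousAt_const ht] with s hs
  exact eq_of_lt hs

/-- Two integral curves of a Lipschitz vector field separate at most exponentially, in both time
directions. -/
theorem dist_le_of_hasDerivAt_of_lipschitzWith (hf : LipschitzWith K f) {w z : ℝ → E}
    (hw : ∀ t, HasDerivAt w (f (w t)) t) (hz : ∀ t, HasDerivAt z (f (z t)) t) (t : ℝ) :
    dist (w t) (z t) ≤ dist (w 0) (z 0) * exp (K * |t|) := by
  have forward {g : E → E} (hg : LipschitzWith K g) {w z : ℝ → E}
      (hw : ∀ t, HasDerivAt w (g (w t)) t) (hz : ∀ t, HasDerivAt z (g (z t)) t) {t : ℝ}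
      (ht : 0 ≤ t) : dist (w t) (z t) ≤ dist (w 0) (z 0) * exp (K * t) := by
    simpa using dist_le_of_trajectories_ODE (v := fun _ ↦ g) (a := 0) (b := t) (fun _ ↦ hg)
      (fun s _ ↦ (hw s).continuousAt.continuousWithinAt) (fun s _ ↦ (hw s).hasDerivWithinAt)
      (fun s _ ↦ (hz s).continuousAt.continuousWithinAt) (fun s _ ↦ (hz s).hasDerivWithinAt)
      le_rfl t ⟨ht, le_rfl⟩
  rcases le_total 0 t with ht | ht
  · rw [abs_of_nonneg ht]
    exact forward hf hw hz ht
  · have reverse {y : ℝ → E} (hy : ∀ t, HasDerivAt y (f (y t)) t) (s : ℝ) :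
        HasDerivAt (fun s ↦ y (-s)) (-f (y (-s))) s := by
      simpa [Function.comp_def] using (hy (-s)).scomp s (hasDerivAt_neg s)
    rw [abs_of_nonpos ht]
    simpa using forward (g := fun x ↦ -f x) hf.neg (reverse hw) (reverse hz) (neg_nonneg.mpr ht)

theorem tendsto_of_tendsto_zero_of_lipschitzWith (hf : LipschitzWith K f) {w : ℕ → ℝ → E}
    {z : ℝ → E} (hw : ∀ n t, HasDerivAt (w n) (f (w n t)) t)
    (hz : ∀ t, HasDerivAt z (f (z t)) t)
    (h0 : Tendsto (fun n ↦ w n 0) atTop (𝓝 (z 0))) (t : ℝ) :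
    Tendsto (fun n ↦ w n t) atTop (𝓝 (z t)) := by
  rw [tendsto_iff_dist_tendsto_zero] at h0 ⊢
  refine squeeze_zero (fun _ ↦ dist_nonneg)
    (fun n ↦ dist_le_of_hasDerivAt_of_lipschitzWith hf (hw n) hz t) ?_
  simpa using h0.mul_const (exp (K * |t|))

end GlobalFlow

/-- If a real function and its derivative both converge at infinity, the derivative tends to zero. -/
theorem derivative_limit_eq_zero_of_tendsto_atTop {g g' : ℝ → ℝ} {l l' : ℝ}
    (hg : ∀ t, HasDerivAt g (g' t) t) (hl : Tendsto g atTop (𝓝 l))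
    (hl' : Tendsto g' atTop (𝓝 l')) : l' = 0 := by
  have mvt (t : ℝ) : ∃ s ∈ Ioo t (t + 1), g' s = g (t + 1) - g t := by
    obtain ⟨s, hs, h⟩ := exists_hasDerivAt_eq_slope g g' (lt_add_one t)
      (fun s _ ↦ (hg s).continuousAt.continuousWithinAt) (fun s _ ↦ hg s)
    exact ⟨s, hs, by simpa using h⟩
  choose s hs heq using mvt
  have hs_top : Tendsto s atTop atTop := tendsto_atTop_mono (fun t ↦ (hs t).1.le) tendsto_id
  have h1 : Tendsto (fun t ↦ g (t + 1) - g t) atTop (𝓝 (l - l)) :=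
    (hl.comp (tendsto_atTop_add_const_right _ 1 tendsto_id)).sub hl
  rw [sub_self] at h1
  exact tendsto_nhds_unique (hl'.comp hs_top) (h1.congr fun t ↦ (heq t).symm)

theorem derivative_limit_eq_zero_of_tendsto_atBot {g g' : ℝ → ℝ} {l l' : ℝ}
    (hg : ∀ t, HasDerivAt g (g' t) t) (hl : Tendsto g atBot (𝓝 l))
    (hl' : Tendsto g' atBot (𝓝 l')) : l' = 0 := by
  refine neg_eq_zero.mp <| derivative_limit_eq_zero_of_tendsto_atTop (g := fun t ↦ g (-t))
    (g' := fun t ↦ -g' (-t)) (fun t ↦ ?_) (hl.comp tendsto_neg_atTop_atBot)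
    (hl'.comp tendsto_neg_atTop_atBot).neg
  simpa [Function.comp_def] using (hg (-t)).scomp t (hasDerivAt_neg t)

/-- The differential inequality `g' + C g ≥ 0` on `[0, T]` keeps a positive function positive. -/
theorem pos_of_derivative_add_mul_nonneg {g g' : ℝ → ℝ} {C T : ℝ} (hT : 0 ≤ T)
    (hg : ∀ t, HasDerivAt g (g' t) t) (h : ∀ t ∈ Ioo 0 T, 0 ≤ g' t + C * g t) (h0 : 0 < g 0) :
    0 < g T := by
  have hd (t : ℝ) : HasDerivAt (fun t ↦ exp (C * t) * g t)
      (exp (C * t) * (g' t + C * g t)) t := by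
    refine ((hasDerivAt_const_mul C).exp.mul (hg t)).congr_deriv ?_
    ring
  have hmono : MonotoneOn (fun t ↦ exp (C * t) * g t) (Icc 0 T) := by
    refine monotoneOn_of_deriv_nonneg (convex_Icc 0 T)
      (fun t _ ↦ (hd t).continuousAt.continuousWithinAt)
      (fun t _ ↦ (hd t).differentiableAt.differentiableWithinAt) fun t ht ↦ ?_
    rw [interior_Icc] at ht
    rw [(hd t).deriv]
    exact mul_nonneg (exp_pos _).le (h t ht)
  have := hmono ⟨le_rfl, hT⟩ ⟨hT, le_rfl⟩ hT
  simp only [mul_zero, exp_zero, one_mul] at this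
  exact pos_of_mul_pos_right (h0.trans_le this) (exp_pos _).le

theorem HasDerivAt.fst_comp {z : ℝ → ℝ × ℝ} {z' : ℝ × ℝ} {t : ℝ} (hz : HasDerivAt z z' t) :
    HasDerivAt (fun t ↦ (z t).1) z'.1 t := by
  simpa using (HasFDerivAt.fst hz.hasFDerivAt).hasDerivAt

theorem HasDerivAt.snd_comp {z : ℝ → ℝ × ℝ} {z' : ℝ × ℝ} {t : ℝ} (hz : HasDerivAt z z' t) :
    HasDerivAt (fun t ↦ (z t).2) z'.2 t := by
  simpa using (HasFDerivAt.snd hz.hasFDerivAt).hasDerivAt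

theorem exists_tendsto_atTop_of_monotone {g : ℝ → ℝ × ℝ} (hg : Monotone g) {a b : ℝ × ℝ}
    (h : ∀ t, g t ∈ Icc a b) : ∃ q, Tendsto g atTop (𝓝 q) :=
  ⟨_, (tendsto_atTop_ciSup (fun _ _ hst ↦ (hg hst).1)
      ⟨b.1, forall_mem_range.mpr fun t ↦ (h t).2.1⟩).prodMk_nhds
    (tendsto_atTop_ciSup (fun _ _ hst ↦ (hg hst).2)
      ⟨b.2, forall_mem_range.mpr fun t ↦ (h t).2.2⟩)⟩

theorem exists_tendsto_atBot_of_monotone {g : ℝ → ℝ × ℝ} (hg : Monotone g) {a b : ℝ × ℝ}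
    (h : ∀ t, g t ∈ Icc a b) : ∃ q, Tendsto g atBot (𝓝 q) :=
  ⟨_, (tendsto_atBot_ciInf (fun _ _ hst ↦ (hg hst).1)
      ⟨a.1, forall_mem_range.mpr fun t ↦ (h t).1.1⟩).prodMk_nhds
    (tendsto_atBot_ciInf (fun _ _ hst ↦ (hg hst).2)
      ⟨a.2, forall_mem_range.mpr fun t ↦ (h t).1.2⟩)⟩

theorem vectorField_eq_zero_of_tendsto_atTop {f : ℝ × ℝ → ℝ × ℝ} (hf : Continuous f)
    {z : ℝ → ℝ × ℝ} (hz : ∀ t, HasDerivAt z (f (z t)) t) {q : ℝ × ℝ}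
    (hq : Tendsto z atTop (𝓝 q)) : f q = 0 := by
  have hfq : Tendsto (fun t ↦ f (z t)) atTop (𝓝 (f q)) := (hf.tendsto q).comp hq
  exact Prod.ext
    (derivative_limit_eq_zero_of_tendsto_atTop (fun t ↦ (hz t).fst_comp) hq.fst_nhds hfq.fst_nhds)
    (derivative_limit_eq_zero_of_tendsto_atTop (fun t ↦ (hz t).snd_comp) hq.snd_nhds hfq.snd_nhds)

theorem vectorField_eq_zero_of_tendsto_atBot {f : ℝ × ℝ → ℝ × ℝ} (hf : Continuous f)
    {z : ℝ → ℝ × ℝ} (hz : ∀ t, HasDerivAt z (f (z t)) t) {q : ℝ × ℝ}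
    (hq : Tendsto z atBot (𝓝 q)) : f q = 0 := by
  have hfq : Tendsto (fun t ↦ f (z t)) atBot (𝓝 (f q)) := (hf.tendsto q).comp hq
  exact Prod.ext
    (derivative_limit_eq_zero_of_tendsto_atBot (fun t ↦ (hz t).fst_comp) hq.fst_nhds hfq.fst_nhds)
    (derivative_limit_eq_zero_of_tendsto_atBot (fun t ↦ (hz t).snd_comp) hq.snd_nhds hfq.snd_nhds)

section PhasePlane

/-- The planar vector field `(X, Y) ↦ (X (k Y - 2 X), -Y² - c Y + X - X Y)`. -/
def phaseField (k c : ℝ) (q : ℝ × ℝ) : ℝ × ℝ :=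
  (q.1 * (k * q.2 - 2 * q.1), -q.2 ^ 2 - c * q.2 + q.1 - q.1 * q.2)

/-- The retraction of the plane onto the box `[0, k] × [0, 1]`. -/
def boxClamp (k : ℝ) (q : ℝ × ℝ) : ℝ × ℝ := (max 0 (min k q.1), max 0 (min 1 q.2))

/-- The vector field `phaseField`, made bounded and globally Lipschitz by freezing it outside the
box `[0, k] × [0, 1]`. -/
def clampedField (k c : ℝ) (q : ℝ × ℝ) : ℝ × ℝ := phaseField k c (boxClamp k q)

/-- The closed region between the two isoclines, on which both components of the field are
nonnegative. -/
def trapRegion (k c : ℝ) : Set (ℝ × ℝ) :=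
  {q | 0 ≤ q.1 ∧ 0 ≤ q.2 ∧ q.2 ≤ 1 ∧ 0 ≤ k * q.2 - 2 * q.1 ∧
    0 ≤ -q.2 ^ 2 - c * q.2 + q.1 - q.1 * q.2}

/-- The open region strictly between the two isoclines. -/
def openTrapRegion (k c : ℝ) : Set (ℝ × ℝ) :=
  {q | 0 < q.1 ∧ 0 < k * q.2 - 2 * q.1 ∧ 0 < -q.2 ^ 2 - c * q.2 + q.1 - q.1 * q.2}

/-- The nontrivial critical point of `phaseField`. -/
noncomputable def criticalPoint (k c : ℝ) : ℝ × ℝ :=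
  (k / 2 * ((k - 2 * c) / (k + 2)), (k - 2 * c) / (k + 2))

variable {k c : ℝ}

theorem continuous_phaseField : Continuous (phaseField k c) := by
  unfold phaseField
  fun_prop

theorem isClosed_trapRegion : IsClosed (trapRegion k c) := by
  unfold trapRegion
  refine .and ?_ (.and ?_ (.and ?_ (.and ?_ ?_))) <;> apply isClosed_le <;> fun_prop

theorem isOpen_openTrapRegion : IsOpen (openTrapRegion k c) := by
  unfold openTrapRegion
  refine .and ?_ (.and ?_ ?_) <;> apply isOpen_lt <;> fun_prop

theorem openTrapRegion_subset_trapRegion (hk : 0 < k) (hc : 0 < c) :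
    openTrapRegion k c ⊆ trapRegion k c := by
  rintro ⟨x, y⟩ ⟨hx, hu, hv⟩
  simp only at hx hu hv
  have hy : 0 < y := by
    by_contra! h
    nlinarith
  refine ⟨hx.le, hy.le, ?_, hu.le, hv.le⟩
  by_contra! h
  simp only at h
  nlinarith [mul_pos hc hy]

theorem fst_lt_criticalPoint_of_mem_openTrapRegion (hk : 0 < k) (hc : 0 < c) {q : ℝ × ℝ}
    (hq : q ∈ openTrapRegion k c) : q.1 < (criticalPoint k c).1 := by
  obtain ⟨-, hy, hy1, -, -⟩ := openTrapRegion_subset_trapRegion hk hc hq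
  obtain ⟨x, y⟩ := q
  obtain ⟨hx, hu, hv⟩ := hq
  simp only at hx hu hv hy hy1
  have hy0 : 0 < y := by
    by_contra! h
    nlinarith
  have hle : y ≤ (k - 2 * c) / (k + 2) := by
    rw [le_div_iff₀ (by linarith)]
    have : 0 ≤ y * (k * (1 - y) - 2 * (y + c)) := by nlinarith
    nlinarith [nonneg_of_mul_nonneg_right this hy0]
  change x < k / 2 * ((k - 2 * c) / (k + 2))
  nlinarith

theorem mem_Icc_of_mem_trapRegion (hk : 0 < k) {q : ℝ × ℝ} (hq : q ∈ trapRegion k c) :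
    q ∈ Icc ((0 : ℝ), (0 : ℝ)) (k, 1) := by
  obtain ⟨hx, hy, hy1, hu, -⟩ := hq
  exact ⟨⟨hx, hy⟩, ⟨by nlinarith, hy1⟩⟩

theorem boxClamp_mem_Icc (hk : 0 < k) (q : ℝ × ℝ) :
    boxClamp k q ∈ Icc ((0 : ℝ), (0 : ℝ)) (k, 1) :=
  ⟨⟨le_max_left _ _, le_max_left _ _⟩,
    ⟨max_le hk.le (min_le_left _ _), max_le zero_le_one (min_le_left _ _)⟩⟩

theorem lipschitzWith_boxClamp : LipschitzWith 1 (boxClamp k) := by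
  have h1 := (LipschitzWith.prod_fst (α := ℝ) (β := ℝ)).const_min k |>.const_max 0
  have h2 := (LipschitzWith.prod_snd (α := ℝ) (β := ℝ)).const_min 1 |>.const_max 0
  rw [← max_self (1 : ℝ≥0)]
  exact h1.prodMk h2

theorem clampedField_eq_phaseField (hk : 0 < k) {q : ℝ × ℝ} (hq : q ∈ trapRegion k c) :
    clampedField k c q = phaseField k c q := by
  obtain ⟨⟨hx, hy⟩, ⟨hxk, hy1⟩⟩ := mem_Icc_of_mem_trapRegion hk hq
  simp only at hx hy hxk hy1
  have : boxClamp k q = q := by simp [boxClamp, hx, hy, hxk, hy1]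
  rw [clampedField, this]

theorem exists_lipschitzWith_clampedField (hk : 0 < k) :
    ∃ K, LipschitzWith K (clampedField k c) := by
  have hC1 : ContDiff ℝ 1 (phaseField k c) := by
    unfold phaseField
    fun_prop
  obtain ⟨K, hK⟩ := hC1.contDiffOn.exists_lipschitzOnWith one_ne_zero
    (convex_Icc ((0 : ℝ), (0 : ℝ)) (k, 1)) isCompact_Icc
  refine ⟨K * 1, lipschitzOnWith_univ.mp ?_⟩
  exact hK.comp lipschitzWith_boxClamp.lipschitzOnWith fun q _ ↦ boxClamp_mem_Icc hk q

theorem exists_norm_clampedField_le (hk : 0 < k) :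
    ∃ L : ℝ≥0, ∀ q, ‖clampedField k c q‖ ≤ L := by
  obtain ⟨C, hC⟩ :=
    (isCompact_Icc (a := ((0 : ℝ), (0 : ℝ))) (b := (k, 1))).exists_bound_of_continuousOn
      (continuous_phaseField (k := k) (c := c)).continuousOn
  exact ⟨C.toNNReal, fun q ↦ (hC _ (boxClamp_mem_Icc hk q)).trans (le_coe_toNNReal C)⟩

/-- The critical points of the field in the trapping region. -/
theorem eq_zero_or_eq_criticalPoint (hk : 0 < k) (hc : 0 < c) {q : ℝ × ℝ}
    (hq : q ∈ trapRegion k c) (h : phaseField k c q = 0) : q = 0 ∨ q = criticalPoint k c := by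
  obtain ⟨x, y⟩ := q
  obtain ⟨hx, hy, hy1, hu, hv⟩ := hq
  simp only [phaseField, Prod.mk_eq_zero] at hx hy hy1 hu hv h
  rcases hy.eq_or_lt with rfl | hy0
  · left
    ext
    · change x = 0
      linarith [h.2]
    · rfl
  · right
    have hx0 : x ≠ 0 := by
      rintro rfl
      nlinarith [h.2]
    have hxy : x = k / 2 * y := by
      have := (mul_eq_zero.mp h.1).resolve_left hx0
      linarith
    have hyval : y = (k - 2 * c) / (k + 2) := by
      rw [eq_div_iff (by linarith)]
      have h2 := h.2
      rw [hxy] at h2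
      have : y * (y * (k + 2) - (k - 2 * c)) = 0 := by linarith
      linarith [(mul_eq_zero.mp this).resolve_left hy0.ne']
    rw [criticalPoint, ← hyval, ← hxy]

variable {z : ℝ → ℝ × ℝ}

theorem monotoneOn_of_mapsTo_trapRegion (hk : 0 < k)
    (hz : ∀ t, HasDerivAt z (clampedField k c (z t)) t) {D : Set ℝ} (hD : Convex ℝ D)
    (h : ∀ t ∈ D, z t ∈ trapRegion k c) : MonotoneOn z D := by
  have hfst : MonotoneOn (fun t ↦ (z t).1) D := by
    refine monotoneOn_of_deriv_nonneg hD (fun t _ ↦ (hz t).fst_comp.continuousAt.continuousWithinAt)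
      (fun t _ ↦ (hz t).fst_comp.differentiableAt.differentiableWithinAt) fun t ht ↦ ?_
    have hR := h t (interior_subset ht)
    rw [(hz t).fst_comp.deriv, clampedField_eq_phaseField hk hR]
    exact mul_nonneg hR.1 hR.2.2.2.1
  have hsnd : MonotoneOn (fun t ↦ (z t).2) D := by
    refine monotoneOn_of_deriv_nonneg hD (fun t _ ↦ (hz t).snd_comp.continuousAt.continuousWithinAt)
      (fun t _ ↦ (hz t).snd_comp.differentiableAt.differentiableWithinAt) fun t ht ↦ ?_
    have hR := h t (interior_subset ht)
    rw [(hz t).snd_comp.deriv, clampedField_eq_phaseField hk hR]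
    exact hR.2.2.2.2
  exact fun s hs t ht hst ↦ ⟨hfst hs ht hst, hsnd hs ht hst⟩

/-- In the trapping region the first coordinate grows at most like `exp (k t)`. -/
theorem fst_le_fst_mul_exp (hk : 0 < k) (hz : ∀ t, HasDerivAt z (clampedField k c (z t)) t)
    {s t : ℝ} (hst : s ≤ t) (h : ∀ r ∈ Icc s t, z r ∈ trapRegion k c) :
    (z t).1 ≤ (z s).1 * exp (k * (t - s)) := by
  have hd (r : ℝ) : HasDerivAt (fun r ↦ exp (-(k * r)) * (z r).1)
      (exp (-(k * r)) * ((clampedField k c (z r)).1 - k * (z r).1)) r := by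
    refine ((hasDerivAt_const_mul k).fun_neg.exp.mul (hz r).fst_comp).congr_deriv ?_
    ring
  have hanti : AntitoneOn (fun r ↦ exp (-(k * r)) * (z r).1) (Icc s t) := by
    refine antitoneOn_of_deriv_nonpos (convex_Icc s t)
      (fun r _ ↦ (hd r).continuousAt.continuousWithinAt)
      (fun r _ ↦ (hd r).differentiableAt.differentiableWithinAt) fun r hr ↦ ?_
    have hR := h r (interior_subset hr)
    rw [(hd r).deriv, clampedField_eq_phaseField hk hR]
    obtain ⟨hx, hy, hy1, hu, -⟩ := hR
    refine mul_nonpos_of_nonneg_of_nonpos (exp_pos _).le ?_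
    simp only [phaseField]
    nlinarith [mul_nonneg (mul_nonneg hk.le hx) (sub_nonneg.mpr hy1), mul_self_nonneg (z r).1]
  have key := hanti ⟨le_rfl, hst⟩ ⟨hst, le_rfl⟩ hst
  simp only at key
  calc (z t).1 = exp (k * t) * (exp (-(k * t)) * (z t).1) := by
        rw [← mul_assoc, ← exp_add]; simp
    _ ≤ exp (k * t) * (exp (-(k * s)) * (z s).1) := by gcongr
    _ = (z s).1 * exp (k * (t - s)) := by
        rw [← mul_assoc, ← exp_add, mul_comm]; ring_nf

/-- The open region between the isoclines is positively invariant. -/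
theorem mem_openTrapRegion_of_nonneg (hk : 0 < k) (hc : 0 < c)
    (hz : ∀ t, HasDerivAt z (clampedField k c (z t)) t) (h0 : z 0 ∈ openTrapRegion k c)
    {t : ℝ} (ht : 0 ≤ t) : z t ∈ openTrapRegion k c := by
  have hcont : Continuous z := continuous_iff_continuousAt.mpr fun t ↦ (hz t).continuousAt
  by_contra hbad
  let S : Set ℝ := Ici 0 ∩ z ⁻¹' (openTrapRegion k c)ᶜ
  have hSbdd : BddBelow S := ⟨0, fun s hs ↦ hs.1⟩
  have hT : sInf S ∈ S :=
    (isClosed_Ici.inter (isOpen_openTrapRegion.isClosed_compl.preimage hcont)).csInf_mem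
      ⟨t, ht, hbad⟩ hSbdd
  set T := sInf S
  have hT0 : 0 ≤ T := hT.1
  have hbefore (s : ℝ) (hs : s ∈ Ico 0 T) : z s ∈ openTrapRegion k c := by
    by_contra hs'
    exact absurd (csInf_le hSbdd ⟨hs.1, hs'⟩) (not_le.mpr hs.2)
  have hIoo (s : ℝ) (hs : s ∈ Ioo 0 T) : z s ∈ trapRegion k c :=
    openTrapRegion_subset_trapRegion hk hc (hbefore s (Ioo_subset_Ico_self hs))
  refine hT.2 ⟨?_, ?_, ?_⟩
  · refine pos_of_derivative_add_mul_nonneg (C := 0) hT0 (fun s ↦ (hz s).fst_comp) (fun s hs ↦ ?_) h0.1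
    have hR := hIoo s hs
    rw [clampedField_eq_phaseField hk hR]
    simpa [phaseField] using mul_nonneg hR.1 hR.2.2.2.1
  · have hd (s : ℝ) := ((hz s).snd_comp.const_mul k).fun_sub ((hz s).fst_comp.const_mul 2)
    refine pos_of_derivative_add_mul_nonneg (g := fun s ↦ k * (z s).2 - 2 * (z s).1) (C := k) hT0
      hd (fun s hs ↦ ?_) h0.2.1
    have hR := hIoo s hs
    have hxk := (mem_Icc_of_mem_trapRegion hk hR).2.1
    rw [clampedField_eq_phaseField hk hR]
    obtain ⟨hx, hy, hy1, hu, hv⟩ := hR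
    have hxk2 : 2 * (z s).1 ≤ k := by nlinarith
    simp only [phaseField]
    nlinarith [mul_nonneg hk.le hv, mul_nonneg hu (sub_nonneg.mpr hxk2)]
  · have hd (s : ℝ) := ((((hz s).snd_comp.fun_pow 2).fun_neg.fun_sub
      ((hz s).snd_comp.const_mul c)).fun_add (hz s).fst_comp).fun_sub
        ((hz s).fst_comp.fun_mul (hz s).snd_comp)
    refine pos_of_derivative_add_mul_nonneg (C := k + 2 + c)
      (g := fun s ↦ -(z s).2 ^ 2 - c * (z s).2 + (z s).1 - (z s).1 * (z s).2) hT0 hd (fun s hs ↦ ?_) h0.2.2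
    have hR := hIoo s hs
    have hxk := (mem_Icc_of_mem_trapRegion hk hR).2.1
    rw [clampedField_eq_phaseField hk hR]
    obtain ⟨hx, hy, hy1, hu, hv⟩ := hR
    simp only [phaseField]
    have h1 := mul_nonneg (mul_nonneg hx (sub_nonneg.mpr hy1)) hu
    have h2 : 0 ≤ (k + 2 - (z s).1 - 2 * (z s).2) *
        (-(z s).2 ^ 2 - c * (z s).2 + (z s).1 - (z s).1 * (z s).2) :=
      mul_nonneg (by simp only at hxk; linarith) hv
    refine (add_nonneg h1 h2).trans_eq ?_
    push_cast
    ring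

/-- An orbit which stays in the trapping region for positive times, away from the origin, converges
to the nontrivial critical point. -/
theorem tendsto_criticalPoint_atTop (hk : 0 < k) (hc : 0 < c)
    (hz : ∀ t, HasDerivAt z (clampedField k c (z t)) t) (h : ∀ t, 0 ≤ t → z t ∈ trapRegion k c)
    (h0 : 0 < (z 0).1) : Tendsto z atTop (𝓝 (criticalPoint k c)) := by
  have hmonoOn := monotoneOn_of_mapsTo_trapRegion hk hz (convex_Ici 0) h
  have hmono : Monotone fun t ↦ z (max 0 t) := fun s t hst ↦
    hmonoOn (mem_Ici.mpr (le_max_left _ _)) (mem_Ici.mpr (le_max_left _ _))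
      (max_le_max le_rfl hst)
  obtain ⟨q, hq'⟩ := exists_tendsto_atTop_of_monotone hmono fun t ↦
    mem_Icc_of_mem_trapRegion hk (h _ (le_max_left _ _))
  have hq : Tendsto z atTop (𝓝 q) := hq'.congr' <| by
    filter_upwards [eventually_ge_atTop 0] with t ht
    rw [max_eq_right ht]
  have hqR : q ∈ trapRegion k c := isClosed_trapRegion.mem_of_tendsto hq <| by
    filter_upwards [eventually_ge_atTop 0] with t ht using h t ht
  have hzero := vectorField_eq_zero_of_tendsto_atTop
    (continuous_phaseField.comp lipschitzWith_boxClamp.continuous) hz hq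
  rcases eq_zero_or_eq_criticalPoint hk hc hqR
    ((clampedField_eq_phaseField hk hqR).symm.trans hzero) with rfl | rfl
  · have : (z 0).1 ≤ 0 := ge_of_tendsto hq.fst_nhds <| by
      filter_upwards [eventually_ge_atTop 0] with t ht
      exact (hmonoOn self_mem_Ici (mem_Ici.mpr ht) ht).1
    exact absurd h0 (not_lt.mpr this)
  · exact hq

/-- A complete orbit in the trapping region which starts to the left of the nontrivial critical
point emanates from the origin. -/
theorem tendsto_zero_atBot (hk : 0 < k) (hc : 0 < c)
    (hz : ∀ t, HasDerivAt z (clampedField k c (z t)) t) (h : ∀ t, z t ∈ trapRegion k c)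
    (h0 : (z 0).1 < (criticalPoint k c).1) : Tendsto z atBot (𝓝 0) := by
  have hmono : Monotone z :=
    monotoneOn_univ.mp (monotoneOn_of_mapsTo_trapRegion hk hz convex_univ fun t _ ↦ h t)
  obtain ⟨q, hq⟩ := exists_tendsto_atBot_of_monotone hmono fun t ↦
    mem_Icc_of_mem_trapRegion hk (h t)
  have hqR : q ∈ trapRegion k c := isClosed_trapRegion.mem_of_tendsto hq (.of_forall h)
  have hzero := vectorField_eq_zero_of_tendsto_atBot
    (continuous_phaseField.comp lipschitzWith_boxClamp.continuous) hz hq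
  rcases eq_zero_or_eq_criticalPoint hk hc hqR
    ((clampedField_eq_phaseField hk hqR).symm.trans hzero) with rfl | rfl
  · exact hq
  · have : (criticalPoint k c).1 ≤ (z 0).1 := le_of_tendsto hq.fst_nhds <| by
      filter_upwards [eventually_le_atBot 0] with t ht
      exact (hmono ht).1
    exact absurd h0 (not_lt.mpr this)

theorem fst_pos_of_mem_trapRegion (hk : 0 < k)
    (hz : ∀ t, HasDerivAt z (clampedField k c (z t)) t) (h : ∀ t, z t ∈ trapRegion k c)
    (h0 : 0 < (z 0).1) (t : ℝ) : 0 < (z t).1 := by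
  rcases le_total 0 t with ht | ht
  · exact h0.trans_le
      (monotoneOn_of_mapsTo_trapRegion hk hz convex_univ (fun t _ ↦ h t) (mem_univ 0)
        (mem_univ t) ht).1
  · exact pos_of_mul_pos_left (h0.trans_le (fst_le_fst_mul_exp hk hz ht fun r _ ↦ h r))
      (exp_pos _).le

/-- Near the origin the ray `Y = s X`, `2 / k < s < 1 / c`, lies in the open
region between the isoclines. -/
theorem exists_ray_subset_openTrapRegion (hk : 0 < k) (hc : 0 < c) (h : 2 * c < k) :
    ∃ s δ : ℝ, 0 < δ ∧ ∀ x ∈ Ioc 0 δ, (x, s * x) ∈ openTrapRegion k c := by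
  obtain ⟨s, hs2, hsc⟩ : ∃ s, 2 / k < s ∧ s < 1 / c :=
    exists_between ((div_lt_div_iff₀ hk hc).mpr (by linarith))
  have hs : 0 < s := (by positivity : 0 < 2 / k).trans hs2
  rw [div_lt_iff₀ hk] at hs2
  rw [lt_div_iff₀ hc] at hsc
  refine ⟨s, (1 - s * c) / (2 * (s + s ^ 2)), by have := sub_pos.mpr hsc; positivity,
    fun x hx ↦ ⟨hx.1, ?_, ?_⟩⟩
  · simp only
    nlinarith [hx.1]
  · have hle := (le_div_iff₀ (by positivity)).mp hx.2
    have : 0 < 1 - s * c - (s + s ^ 2) * x := by linarith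
    have := mul_pos hx.1 this
    simp only
    linarith

/-- There are orbits in the trapping region, on arbitrarily long backward time intervals, which
pass through a fixed vertical line left of the nontrivial critical point. -/
theorem exists_orbit_on_Ici_neg (hk : 0 < k) (hc : 0 < c) {s δ : ℝ} (hδ : 0 < δ)
    (hray : ∀ x ∈ Ioc 0 δ, (x, s * x) ∈ openTrapRegion k c) (n : ℕ) :
    ∃ w : ℝ → ℝ × ℝ, (∀ t, HasDerivAt w (clampedField k c (w t)) t) ∧ (w 0).1 = δ ∧
      ∀ t, -(n : ℝ) ≤ t → w t ∈ trapRegion k c := by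
  obtain ⟨K, hK⟩ := exists_lipschitzWith_clampedField (c := c) hk
  obtain ⟨L, hL⟩ := exists_norm_clampedField_le (c := c) hk
  set x := δ * exp (-(k * n)) with hx_def
  have hx : x ∈ Ioc 0 δ := by
    refine ⟨by positivity, mul_le_of_le_one_right hδ.le (exp_le_one_iff.mpr ?_)⟩
    exact neg_nonpos.mpr (by positivity)
  obtain ⟨z, hz0, hz⟩ := exists_forall_hasDerivAt_of_lipschitzWith_of_bounded hK hL (x, s * x)
  have hopen : z 0 ∈ openTrapRegion k c := hz0 ▸ hray x hx
  have htrap (t : ℝ) (ht : 0 ≤ t) : z t ∈ trapRegion k c :=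
    openTrapRegion_subset_trapRegion hk hc (mem_openTrapRegion_of_nonneg hk hc hz hopen ht)
  have hlim := tendsto_criticalPoint_atTop hk hc hz htrap hopen.1
  have hδ_lt : δ < (criticalPoint k c).1 :=
    fst_lt_criticalPoint_of_mem_openTrapRegion hk hc (hray δ ⟨hδ, le_rfl⟩)
  obtain ⟨T, hT, hT0⟩ :=
    ((hlim.fst_nhds.eventually_const_lt hδ_lt).and (eventually_ge_atTop 0)).exists
  obtain ⟨τ, hτ, hzτ⟩ : δ ∈ (fun t ↦ (z t).1) '' Icc 0 T := by
    refine intermediate_value_Icc hT0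
      (fun t _ ↦ (hz t).fst_comp.continuousAt.continuousWithinAt) ⟨?_, hT.le⟩
    rw [hz0]
    exact hx.2
  have hnτ : (n : ℝ) ≤ τ := by
    have hgrow := fst_le_fst_mul_exp hk hz hτ.1 fun r hr ↦ htrap r hr.1
    simp only at hzτ
    rw [hzτ, hz0, hx_def, mul_assoc, ← exp_add, le_mul_iff_one_le_right hδ,
      one_le_exp_iff] at hgrow
    exact le_of_mul_le_mul_left (by linarith) hk
  refine ⟨fun t ↦ z (t + τ), fun t ↦ (hz (t + τ)).comp_add_const t τ, by simpa using hzτ,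
    fun t ht ↦ htrap _ (by linarith)⟩

/-- The planar system has a heteroclinic orbit from the origin to its nontrivial critical
point. -/
theorem exists_heteroclinic_orbit (hk : 0 < k) (hc : 0 < c) (h : 2 * c < k) :
    ∃ z : ℝ → ℝ × ℝ, (∀ t, HasDerivAt z (phaseField k c (z t)) t) ∧ (∀ t, 0 < (z t).1) ∧
      Tendsto z atBot (𝓝 0) ∧ Tendsto z atTop (𝓝 (criticalPoint k c)) := by
  obtain ⟨s, δ, hδ, hray⟩ := exists_ray_subset_openTrapRegion hk hc h
  choose w hw hw0 hwR using exists_orbit_on_Ici_neg hk hc hδ hray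
  obtain ⟨q, -, φ, hφ, hq⟩ := isCompact_Icc.tendsto_subseq fun n ↦
    mem_Icc_of_mem_trapRegion hk (hwR n 0 (neg_nonpos.mpr n.cast_nonneg))
  obtain ⟨K, hK⟩ := exists_lipschitzWith_clampedField (c := c) hk
  obtain ⟨L, hL⟩ := exists_norm_clampedField_le (c := c) hk
  obtain ⟨z, hz0, hz⟩ := exists_forall_hasDerivAt_of_lipschitzWith_of_bounded hK hL q
  have hlim (t : ℝ) : Tendsto (fun n ↦ w (φ n) t) atTop (𝓝 (z t)) :=
    tendsto_of_tendsto_zero_of_lipschitzWith hK (fun n ↦ hw (φ n)) hz (hz0 ▸ hq) t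
  have hzR (t : ℝ) : z t ∈ trapRegion k c := isClosed_trapRegion.mem_of_tendsto (hlim t) <| by
    filter_upwards [eventually_ge_atTop ⌈-t⌉₊] with n hn
    refine hwR _ t (neg_le.mp ((Nat.le_ceil (-t)).trans ?_))
    exact_mod_cast hn.trans (hφ.id_le n)
  have hzδ : (z 0).1 = δ := tendsto_nhds_unique (hlim 0).fst_nhds (by simp [hw0])
  have hz0_pos : 0 < (z 0).1 := hzδ ▸ hδ
  refine ⟨z, fun t ↦ clampedField_eq_phaseField hk (hzR t) ▸ hz t,
    fst_pos_of_mem_trapRegion hk hz hzR hz0_pos, tendsto_zero_atBot hk hc hz hzR ?_,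
    tendsto_criticalPoint_atTop hk hc hz (fun t _ ↦ hzR t) hz0_pos⟩
  rw [hzδ]
  exact fst_lt_criticalPoint_of_mem_openTrapRegion hk hc (hray δ ⟨hδ, le_rfl⟩)

end PhasePlane

/-- heteroclinic connection between the critical points
`P₀ = (0,0)` and `P₂ = ((m-1)/(2(m+1)α), 1/((m+1)α))` of the phase-plane
system in the invariant plane `{Z = 0}`. -/
theorem heteroclinic_P0_P2 (m p σ α β : ℝ)
    (hm : 1 < m) (hp0 : 0 < p) (hp1 : p < 1)
    (hσ : 2 * (1 - p) / (m - 1) < σ)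
    (hα : α = (σ + 2) / (σ * (m - 1) + 2 * (p - 1)))
    (hβ : β = (m - p) / (σ * (m - 1) + 2 * (p - 1))) :
    ∃ X Y : ℝ → ℝ,
      (∀ η : ℝ, 0 < X η) ∧
      Differentiable ℝ X ∧ Differentiable ℝ Y ∧
      (∀ η : ℝ, deriv X η = X η * ((m - 1) * Y η - 2 * X η)) ∧
      (∀ η : ℝ, deriv Y η =
        -(Y η) ^ 2 - (β / α) * Y η + X η - X η * Y η) ∧
      Filter.Tendsto (fun η => (X η, Y η)) Filter.atBot
        (nhds ((0 : ℝ), (0 : ℝ))) ∧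
      Filter.Tendsto (fun η => (X η, Y η)) Filter.atTop
        (nhds ((m - 1) / (2 * (m + 1) * α), 1 / ((m + 1) * α))) := by
  have hD : 0 < σ * (m - 1) + 2 * (p - 1) := by
    have := (div_lt_iff₀ (sub_pos.mpr hm)).mp hσ
    linarith
  have hσ0 : 0 < σ := (div_pos (by linarith) (by linarith)).trans hσ
  have hc : β / α = (m - p) / (σ + 2) := by
    rw [hα, hβ, div_div_div_cancel_right₀ hD.ne']
  have hc0 : 0 < β / α := by
    rw [hc]
    exact div_pos (by linarith) (by linarith)
  have hαinv : m - 1 - 2 * (β / α) = 1 / α := by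
    rw [hc, hα]
    field_simp
    ring
  have hα0 : 0 < α := hα ▸ div_pos (by linarith) hD
  have hck : 2 * (β / α) < m - 1 := by
    have : 0 < 1 / α := by positivity
    linarith
  obtain ⟨z, hz, hpos, hbot, htop⟩ := exists_heteroclinic_orbit (sub_pos.mpr hm) hc0 hck
  refine ⟨fun t ↦ (z t).1, fun t ↦ (z t).2, hpos, fun t ↦ (hz t).fst_comp.differentiableAt,
    fun t ↦ (hz t).snd_comp.differentiableAt, fun t ↦ (hz t).fst_comp.deriv,
    fun t ↦ (hz t).snd_comp.deriv, hbot, ?_⟩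
  convert htop using 2
  have hm1 : m + 1 ≠ 0 := by linarith
  rw [criticalPoint, hαinv, show m - 1 + 2 = m + 1 by ring]
  ext <;> simp only <;> field_simp
end
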